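/- arXiv:1607.05067 — 7 statements merged into one kernel-verified Lean document; each statement's English description precedes it below -/
import Mathlib

section
/- Let f(z) = z + Σ_{n≥2} a_n zⁿ be analytic on the unit disk 𝔻 and satisfy zf'(z)/f(z) ≺ (1+Az)/(1+Bz) for some -1 ≤ B < A ≤ 1 (i.e., f ∈ S*(A,B)). Fix λ > 0 and write (f(z)/z)^{-λ} = 1 + Σ_{n≥1} a_n(-λ,f) zⁿ on 𝔻. Then for every l ≥ 1, l² |a_l(-λ,f)|² ≤ λ²(A-B)² + Σ_{n=1}^{l-1} [(λ(A-B)+nB)² - n²] |a_n(-λ,f)|². -/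
open Metric Complex

/-- The class `S*(A,B)`. -/
def IsJanowskiStarlike (A B : ℝ) (f : ℂ → ℂ) : Prop :=
  AnalyticOn ℂ f (ball 0 1) ∧ f 0 = 0 ∧ deriv f 0 = 1 ∧
    ∃ ω : ℂ → ℂ, AnalyticOn ℂ ω (ball 0 1) ∧ (∀ z ∈ ball (0 : ℂ) 1, ‖ω z‖ ≤ 1) ∧
      ∀ z ∈ ball (0 : ℂ) 1,
        z * deriv f z * (1 + (B : ℂ) * z * ω z) = f z * (1 + (A : ℂ) * z * ω z)

/-- `a` is the sequence of Taylor coefficients of the branch of `(f z / z) ^ (-lam)`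
normalized to equal `1` at the origin. -/
def NegPowCoeff (lam : ℝ) (f : ℂ → ℂ) (a : ℕ → ℂ) : Prop :=
  ∃ h : ℂ → ℂ, AnalyticOn ℂ h (ball 0 1) ∧ h 0 = 0 ∧
    (∀ z ∈ ball (0 : ℂ) 1, f z = z * Complex.exp (h z)) ∧
    a 0 = 1 ∧
    ∀ z ∈ ball (0 : ℂ) 1,
      HasSum (fun n : ℕ => a n * z ^ n) (Complex.exp (-(lam : ℂ) * h z))

/-- `F` is the sum of the power series with coefficients `c` on the unit disk. -/
def PS (c : ℕ → ℂ) (F : ℂ → ℂ) : Prop :=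
  ∀ z ∈ ball (0 : ℂ) 1, HasSum (fun n : ℕ => c n * z ^ n) (F z)

lemma PS.onBall {c : ℕ → ℂ} {F : ℂ → ℂ} (h : PS c F) :
    HasFPowerSeriesOnBall F (FormalMultilinearSeries.ofScalars ℂ c) 0 1 := by
  refine ⟨?_, by norm_num, ?_⟩
  · refine ENNReal.le_of_forall_nnreal_lt fun r hr => ?_
    apply FormalMultilinearSeries.le_radius_of_summable
    have hr' : (r : ℝ) < 1 := by exact_mod_cast hr
    have := (h (r : ℂ) (by simpa using hr')).summable.norm
    refine this.congr fun n => ?_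
    simp
  · intro y hy
    have hy' : y ∈ ball (0 : ℂ) 1 := by
      have := hy
      rw [← ENNReal.ofReal_one, Metric.eball_ofReal] at this
      exact this
    have := h y hy'
    simpa [FormalMultilinearSeries.ofScalars, mul_comm] using this

lemma PS.diff {c : ℕ → ℂ} {F : ℂ → ℂ} (h : PS c F) : DifferentiableOn ℂ F (ball 0 1) := by
  have := h.onBall.differentiableOn
  rwa [← ENNReal.ofReal_one, Metric.eball_ofReal] at this

lemma PS.unique {c d : ℕ → ℂ} {F : ℂ → ℂ} (hc : PS c F) (hd : PS d F) : c = d := by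
  have := hc.onBall.hasFPowerSeriesAt.eq_formalMultilinearSeries hd.onBall.hasFPowerSeriesAt
  funext n
  have h2 := congrArg (fun p => FormalMultilinearSeries.coeff p n) this
  simpa [FormalMultilinearSeries.coeff_ofScalars] using h2

lemma ps_taylor {F : ℂ → ℂ} (hF : DifferentiableOn ℂ F (ball 0 1)) :
    PS (fun n => (n.factorial : ℂ)⁻¹ * iteratedDeriv n F 0) F := by
  intro z hz
  have := Complex.hasSum_taylorSeries_on_ball hF hz
  refine this.congr_fun fun n => ?_
  simp
  ring

lemma PS.deriv {c : ℕ → ℂ} {F : ℂ → ℂ} (h : PS c F) :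
    PS (fun n => ((n : ℂ) + 1) * c (n + 1)) (deriv F) := by
  have h1 := h.unique (ps_taylor h.diff)
  have h2 := ps_taylor (h.diff.deriv isOpen_ball)
  convert h2 using 2 with n
  rw [h1]
  simp only
  rw [iteratedDeriv_succ', Nat.factorial_succ]
  have : (n : ℂ) + 1 ≠ 0 := by exact_mod_cast Nat.succ_ne_zero n
  push_cast
  field_simp

lemma PS.mul {c d : ℕ → ℂ} {F G : ℂ → ℂ} (hc : PS c F) (hd : PS d G) :
    PS (fun n => ∑ k ∈ Finset.HasAntidiagonal.antidiagonal n, c k.1 * d k.2) (fun z => F z * G z) := by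
  intro z hz
  have h1 := (hc z hz).summable.norm
  have h2 := (hd z hz).summable.norm
  have h3 := tsum_mul_tsum_eq_tsum_sum_antidiagonal_of_summable_norm h1 h2
  have h4 := (summable_norm_sum_mul_antidiagonal_of_summable_norm h1 h2).of_norm.hasSum
  rw [← h3, (hc z hz).tsum_eq, (hd z hz).tsum_eq] at h4
  refine h4.congr_fun fun n => ?_
  simp only
  rw [Finset.sum_mul]
  refine Finset.sum_congr rfl fun k hk => ?_
  rw [← Finset.HasAntidiagonal.mem_antidiagonal.mp hk, pow_add]
  ring

lemma PS.shift {c : ℕ → ℂ} {F : ℂ → ℂ} (h : PS c F) :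
    ∃ G, PS (fun n => c (n + 1)) G ∧ ∀ z ∈ ball (0 : ℂ) 1, F z = c 0 + z * G z := by
  have hs : ∀ z ∈ ball (0 : ℂ) 1, Summable (fun n => c (n + 1) * z ^ n) := by
    intro z hz
    by_cases h0 : z = 0
    · subst h0
      refine summable_of_ne_finset_zero (s := {0}) fun n hn => ?_
      simp at hn
      simp [hn]
    · have := ((summable_nat_add_iff 1).mpr (h z hz).summable).mul_left z⁻¹
      refine this.congr fun n => ?_
      rw [pow_succ]
      field_simp
  refine ⟨fun z => ∑' n, c (n + 1) * z ^ n, fun z hz => (hs z hz).hasSum, fun z hz => ?_⟩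
  rw [← (h z hz).tsum_eq, (h z hz).summable.tsum_eq_zero_add, ← tsum_mul_left]
  simp only [pow_zero, mul_one]
  congr 2
  funext n
  ring

lemma PS.circleInt {c : ℕ → ℂ} {F : ℂ → ℂ} (h : PS c F) {r : ℝ} (hr0 : 0 < r) (hr : r < 1) :
    CircleIntegrable (fun z => ‖F z‖ ^ 2) 0 r := by
  apply ContinuousOn.circleIntegrable hr0.le
  refine (h.diff.continuousOn.mono ?_).norm.pow 2
  intro z hz
  simp at hz ⊢
  linarith

lemma PS.step {c : ℕ → ℂ} {F G : ℂ → ℂ} (hG : PS (fun n => c (n + 1)) G)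
    (hFG : ∀ z ∈ ball (0 : ℂ) 1, F z = c 0 + z * G z) {r : ℝ} (hr0 : 0 < r) (hr : r < 1) :
    Real.circleAverage (fun z => ‖F z‖ ^ 2) 0 r =
      ‖c 0‖ ^ 2 + r ^ 2 * Real.circleAverage (fun z => ‖G z‖ ^ 2) 0 r := by
  have habs : |r| = r := abs_of_pos hr0
  have hcb : closedBall (0 : ℂ) r ⊆ ball 0 1 := closedBall_subset_ball hr
  have hsb : sphere (0 : ℂ) r ⊆ ball 0 1 := sphere_subset_closedBall.trans hcb
  set H : ℂ → ℂ := fun z => (starRingEnd ℂ) (c 0) * (z * G z) with hH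
  have hHd : DifferentiableOn ℂ H (ball 0 1) :=
    (differentiableOn_id.mul hG.diff).const_mul _
  have hHi : CircleIntegrable H 0 r :=
    (hHd.continuousOn.mono hsb).circleIntegrable hr0.le
  have hH0 : Real.circleAverage H 0 r = 0 := by
    have : DiffContOnCl ℂ H (ball 0 |r|) := by
      rw [habs]
      exact hHd.diffContOnCl_ball hcb
    rw [this.circleAverage]
    simp [hH]
  have hre : Real.circleAverage (fun z => (H z).re) 0 r = 0 := by
    have := Complex.reCLM.circleAverage_comp_comm hHi
    rw [hH0] at this
    simpa [Function.comp_def] using this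
  have hreI : CircleIntegrable (fun z => (H z).re) 0 r :=
    (Complex.continuous_re.comp_continuousOn (hHd.continuousOn.mono hsb)).circleIntegrable hr0.le
  have hGi := hG.circleInt hr0 hr
  have e1 : Real.circleAverage (fun z => ‖F z‖ ^ 2) 0 r =
      Real.circleAverage (fun z => ‖c 0‖ ^ 2 + ((2 : ℝ) • (H z).re + (r ^ 2) • ‖G z‖ ^ 2)) 0 r := by
    apply Real.circleAverage_congr_sphere
    intro z hz
    rw [habs] at hz
    have hz' : ‖z‖ = r := by simpa using hz
    simp only [hFG z (hsb hz), smul_eq_mul, hH]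
    rw [← hz']
    simp only [← Complex.normSq_eq_norm_sq, Complex.normSq_apply, Complex.add_re, Complex.add_im,
      Complex.mul_re, Complex.mul_im, Complex.conj_re, Complex.conj_im]
    ring
  have i1 : CircleIntegrable (fun z => (2 : ℝ) • (H z).re) 0 r := hreI.const_smul
  have i2 : CircleIntegrable (fun z => (r ^ 2) • ‖G z‖ ^ 2) 0 r := hGi.const_smul
  have i3 : CircleIntegrable (fun z => (2 : ℝ) • (H z).re + (r ^ 2) • ‖G z‖ ^ 2) 0 r := i1.add i2
  rw [e1, Real.circleAverage_fun_add (circleIntegrable_const _ _ _) i3,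
    Real.circleAverage_fun_add i1 i2, Real.circleAverage_fun_smul, Real.circleAverage_fun_smul,
    hre, Real.circleAverage_const]
  simp

lemma PS.bessel (N : ℕ) : ∀ {c : ℕ → ℂ} {F : ℂ → ℂ} (_ : PS c F) {r : ℝ} (_ : 0 < r) (_ : r < 1),
    ∑ n ∈ Finset.range N, ‖c n‖ ^ 2 * (r ^ 2) ^ n ≤
      Real.circleAverage (fun z => ‖F z‖ ^ 2) 0 r := by
  induction N with
  | zero =>
    intro c F h r hr0 hr
    simp only [Finset.range_zero, Finset.sum_empty]
    exact Real.circleAverage_nonneg_of_nonneg fun z _ => by positivity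
  | succ N ih =>
    intro c F h r hr0 hr
    obtain ⟨G, hG, hFG⟩ := h.shift
    rw [PS.step hG hFG hr0 hr, Finset.sum_range_succ', add_comm]
    have := mul_le_mul_of_nonneg_left (ih hG hr0 hr) (sq_nonneg r)
    rw [Finset.mul_sum] at this
    simp only [pow_zero, mul_one]
    gcongr
    refine le_trans (le_of_eq ?_) this
    refine Finset.sum_congr rfl fun n _ => ?_
    ring

lemma PS.parseval (N : ℕ) : ∀ {c : ℕ → ℂ} {F : ℂ → ℂ} (_ : PS c F) (_ : ∀ n, N ≤ n → c n = 0)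
    {r : ℝ} (_ : 0 < r) (_ : r < 1),
    Real.circleAverage (fun z => ‖F z‖ ^ 2) 0 r =
    ∑ n ∈ Finset.range N, ‖c n‖ ^ 2 * (r ^ 2) ^ n := by
  induction N with
  | zero =>
    intro c F h hc r hr0 hr
    simp only [Finset.range_zero, Finset.sum_empty]
    apply Real.circleAverage_const_on_circle
    intro z hz
    rw [abs_of_pos hr0] at hz
    have hz' : ‖z‖ = r := by simpa using hz
    have h1 := h z (by simpa [hz'] using hr)
    have h2 : (fun n => c n * z ^ n) = fun _ => 0 := by
      funext n
      simp [hc n (Nat.zero_le n)]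
    rw [h2] at h1
    rw [h1.unique hasSum_zero]
    simp
  | succ N ih =>
    intro c F h hc r hr0 hr
    obtain ⟨G, hG, hFG⟩ := h.shift
    rw [PS.step hG hFG hr0 hr, Finset.sum_range_succ', add_comm,
      ih hG (fun n hn => hc (n + 1) (by omega)) hr0 hr, Finset.mul_sum]
    simp only [pow_zero, mul_one]
    congr 1
    refine Finset.sum_congr rfl fun n _ => ?_
    ring

/-- Contractivity of truncated Toeplitz operators with symbol in the unit ball of `H^∞`. -/
lemma schur_trunc {w c : ℕ → ℂ} {W : ℂ → ℂ} (hw : PS w W)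
    (hW : ∀ z ∈ ball (0 : ℂ) 1, ‖W z‖ ≤ 1) (l : ℕ) :
    ∑ n ∈ Finset.range l, ‖∑ k ∈ Finset.HasAntidiagonal.antidiagonal n, w k.1 * c k.2‖ ^ 2 ≤
      ∑ n ∈ Finset.range l, ‖c n‖ ^ 2 := by
  set p : ℕ → ℂ := fun n => if n < l then c n else 0 with hp
  set P : ℂ → ℂ := fun z => ∑ n ∈ Finset.range l, p n * z ^ n
  have hP : PS p P := fun z _ => hasSum_sum_of_ne_finset_zero fun n hn => by
    simp at hn
    simp [hp, hn]
  have key : ∀ r : ℝ, 0 < r → r < 1 →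
      ∑ n ∈ Finset.range l, ‖∑ k ∈ Finset.HasAntidiagonal.antidiagonal n, w k.1 * c k.2‖ ^ 2 * (r ^ 2) ^ n ≤
      ∑ n ∈ Finset.range l, ‖c n‖ ^ 2 * (r ^ 2) ^ n := by
    intro r hr0 hr
    have h1 := (hw.mul hP).bessel l hr0 hr
    have h2 := hP.parseval l (fun n hn => by simp [hp, hn]) hr0 hr
    have h3 : Real.circleAverage (fun z => ‖W z * P z‖ ^ 2) 0 r ≤
        Real.circleAverage (fun z => ‖P z‖ ^ 2) 0 r := by
      refine Real.circleAverage_mono ((hw.mul hP).circleInt hr0 hr) (hP.circleInt hr0 hr) ?_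
      intro z hz
      rw [abs_of_pos hr0] at hz
      have hz' : ‖z‖ = r := by simpa using hz
      have := hW z (by simpa [hz'] using hr)
      rw [norm_mul]
      gcongr
      exact mul_le_of_le_one_left (norm_nonneg _) this
    rw [h2] at h3
    refine le_trans (le_of_eq ?_) ((h1.trans h3).trans (le_of_eq ?_))
    · refine Finset.sum_congr rfl fun n hn => ?_
      congr 3
      refine Finset.sum_congr rfl fun k hk => ?_
      have := Finset.HasAntidiagonal.mem_antidiagonal.mp hk
      have hn' := Finset.mem_range.mp hn
      have : k.2 < l := by omega
      simp [hp, this]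
    · refine Finset.sum_congr rfl fun n hn => ?_
      simp [hp, Finset.mem_range.mp hn]
  have t : ∀ d : ℕ → ℝ, Filter.Tendsto (fun r : ℝ => ∑ n ∈ Finset.range l, d n * (r ^ 2) ^ n)
      (nhdsWithin 1 (Set.Iio 1)) (nhds (∑ n ∈ Finset.range l, d n)) := by
    intro d
    have : Continuous (fun r : ℝ => ∑ n ∈ Finset.range l, d n * (r ^ 2) ^ n) := by fun_prop
    have h := (this.tendsto 1).mono_left (nhdsWithin_le_nhds (s := Set.Iio 1))
    simpa using h
  refine le_of_tendsto_of_tendsto (t _) (t _) ?_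
  have : Set.Ioo (0 : ℝ) 1 ∈ nhdsWithin (1 : ℝ) (Set.Iio 1) := Ioo_mem_nhdsLT (by norm_num)
  filter_upwards [this] with r hr
  exact key r hr.1 hr.2

theorem clunie_inequality (A B lam : ℝ) (hB : -1 ≤ B) (hBA : B < A) (hA : A ≤ 1)
    (hlam : 0 < lam) (f : ℂ → ℂ) (hf : IsJanowskiStarlike A B f)
    (a : ℕ → ℂ) (ha : NegPowCoeff lam f a) (l : ℕ) (hl : 1 ≤ l) :
    (l : ℝ) ^ 2 * ‖a l‖ ^ 2 ≤
      lam ^ 2 * (A - B) ^ 2 +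
        ∑ n ∈ Finset.Icc 1 (l - 1),
          ((lam * (A - B) + n * B) ^ 2 - (n : ℝ) ^ 2) * ‖a n‖ ^ 2 := by
  obtain ⟨hfa, hf0, hf1, ω, hω, hω1, hrel⟩ := hf
  obtain ⟨h, hh, hh0, hfh, ha0, hsum⟩ := ha
  set g : ℂ → ℂ := fun z => Complex.exp (-(lam : ℂ) * h z) with hg
  have hga : PS a g := hsum
  have hw := ps_taylor hω.differentiableOn
  set w : ℕ → ℂ := fun n => (n.factorial : ℂ)⁻¹ * iteratedDeriv n ω 0
  have hg' := hga.deriv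
  have hdg : ∀ z ∈ ball (0 : ℂ) 1, deriv g z = -(lam : ℂ) * deriv h z * g z := by
    intro z hz
    have hd : HasDerivAt h (deriv h z) z :=
      (hh.differentiableOn.differentiableAt (isOpen_ball.mem_nhds hz)).hasDerivAt
    have := (hd.const_mul (-(lam : ℂ))).cexp
    rw [this.deriv]
    simp only [hg]
    ring
  -- the differential relation, first away from the origin
  have hode : ∀ z ∈ ball (0 : ℂ) 1, z ≠ 0 →
      deriv g z = ω z * ((lam : ℂ) * (B - A) * g z - B * (z * deriv g z)) := by
    intro z hz hz0
    have hd : HasDerivAt h (deriv h z) z :=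
      (hh.differentiableOn.differentiableAt (isOpen_ball.mem_nhds hz)).hasDerivAt
    have hdf : deriv f z = Complex.exp (h z) + z * (Complex.exp (h z) * deriv h z) := by
      have h1 : HasDerivAt (fun z => z * Complex.exp (h z))
          (1 * Complex.exp (h z) + z * (Complex.exp (h z) * deriv h z)) z :=
        (hasDerivAt_id z).mul hd.cexp
      have h2 : f =ᶠ[nhds z] fun z => z * Complex.exp (h z) := by
        filter_upwards [isOpen_ball.mem_nhds hz] with y hy using hfh y hy
      rw [h2.deriv_eq, h1.deriv, one_mul]
    have hr := hrel z hz
    rw [hdf, hfh z hz] at hr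
    have hne : z * z * Complex.exp (h z) ≠ 0 :=
      mul_ne_zero (mul_ne_zero hz0 hz0) (Complex.exp_ne_zero _)
    have hr2 : deriv h z * (1 + B * z * ω z) = (A - B) * ω z := by
      apply mul_left_cancel₀ hne
      linear_combination hr
    rw [hdg z hz]
    linear_combination (-(lam : ℂ) * g z) * hr2
  have hcont : ∀ z ∈ ball (0 : ℂ) 1,
      deriv g z = ω z * ((lam : ℂ) * (B - A) * g z - B * (z * deriv g z)) := by
    intro z hz
    by_cases hz0 : z = 0
    · have h0 : ball (0 : ℂ) 1 ∈ nhds z := isOpen_ball.mem_nhds hz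
      have c1 : ContinuousAt (deriv g) z := hg'.diff.continuousOn.continuousAt h0
      have c2 : ContinuousAt g z := hga.diff.continuousOn.continuousAt h0
      have c3 : ContinuousAt ω z := hω.continuousOn.continuousAt h0
      have c4 : ContinuousAt
          (fun z => ω z * ((lam : ℂ) * (B - A) * g z - B * (z * deriv g z))) z := by
        fun_prop
      refine ((c1.eventuallyEq_nhds_iff_eventuallyEq_nhdsNE c4).mp ?_).self_of_nhds
      filter_upwards [self_mem_nhdsWithin, mem_nhdsWithin_of_mem_nhds h0] with y hy hyb
      exact hode y hyb (by simpa [hz0] using hy)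
    · exact hode z hz hz0
  set c : ℕ → ℂ := fun n => ((lam : ℂ) * (B - A) - B * n) * a n with hc
  have hzg : PS (fun n => (n : ℂ) * a n) (fun z => z * deriv g z) := by
    intro z hz
    have h1 := (hg' z hz).mul_left z
    rw [← hasSum_nat_add_iff' 1]
    simp only [Finset.range_one, Finset.sum_singleton, Nat.cast_zero, zero_mul, sub_zero]
    refine h1.congr_fun fun n => ?_
    push_cast
    ring
  have hcP : PS c (fun z => (lam : ℂ) * (B - A) * g z - B * (z * deriv g z)) := by
    intro z hz
    have h1 := ((hga z hz).mul_left ((lam : ℂ) * (B - A))).sub ((hzg z hz).mul_left (B : ℂ))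
    refine h1.congr_fun fun n => ?_
    simp only [hc]
    ring
  have hprod := hw.mul hcP
  have hb : PS (fun n => ((n : ℂ) + 1) * a (n + 1))
      (fun z => ω z * ((lam : ℂ) * (B - A) * g z - B * (z * deriv g z))) := by
    intro z hz
    have h1 := hg' z hz
    rw [hcont z hz] at h1
    exact h1
  have heq := hb.unique hprod
  have hmain := schur_trunc (c := c) hw hω1 l
  have e1 : ∀ n, ‖∑ k ∈ Finset.HasAntidiagonal.antidiagonal n, w k.1 * c k.2‖ ^ 2 =
      ((n : ℝ) + 1) ^ 2 * ‖a (n + 1)‖ ^ 2 := by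
    intro n
    have h1 := congrFun heq n
    rw [show (∑ k ∈ Finset.HasAntidiagonal.antidiagonal n, w k.1 * c k.2) = ((n : ℂ) + 1) * a (n + 1)
      from h1.symm, norm_mul, mul_pow]
    congr 2
    have : ((n : ℂ) + 1) = ((n + 1 : ℕ) : ℂ) := by push_cast; rfl
    rw [this, Complex.norm_natCast]
    push_cast
    rfl
  have e2 : ∀ n, ‖c n‖ ^ 2 = (lam * (A - B) + n * B) ^ 2 * ‖a n‖ ^ 2 := by
    intro n
    have : (lam : ℂ) * (B - A) - B * n = ((-(lam * (A - B) + n * B) : ℝ) : ℂ) := by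
      push_cast
      ring
    simp only [hc]
    rw [norm_mul, mul_pow, this, Complex.norm_real, Real.norm_eq_abs, sq_abs, neg_sq]
  simp only [e1, e2] at hmain
  obtain ⟨m, rfl⟩ : ∃ m, l = m + 1 := ⟨l - 1, by omega⟩
  have hI : ∀ u : ℕ → ℝ, ∑ n ∈ Finset.Icc 1 (m + 1 - 1), u n = ∑ n ∈ Finset.range m, u (n + 1) := by
    intro u
    rw [Nat.add_sub_cancel, Finset.range_eq_Ico, Finset.sum_Ico_add' u 0 m 1]
    rfl
  rw [hI]
  rw [Finset.sum_range_succ, Finset.sum_range_succ'] at hmain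
  simp only [sub_mul, Finset.sum_sub_distrib]
  simp only [ha0, Nat.cast_zero, zero_mul, add_zero, norm_one, one_pow, mul_one] at hmain
  push_cast at hmain ⊢
  simp only [mul_pow] at hmain
  linarith
end

section
/- Let -1 ≤ B < A ≤ 1 and let f ∈ S*(A,B) with Taylor expansion f(z) = z + Σ_{n≥2} a_n zⁿ. Fix 0 < λ ≤ 1 and write (f(z)/z)^{-λ} = 1 + Σ_{n≥1} a_n(-λ,f) zⁿ. Then for every l ≥ 1, |a_l(-λ,f)| ≤ λ(A-B)/l. -/
open Metric Complex

lemma hasSum_cast {p q : ℕ → ℂ} {s t : ℂ} (h : HasSum p s) (hpq : ∀ k, q k = p k) (hst : t = s) :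
    HasSum q t := by
  rw [hst, funext hpq]
  exact h

open Filter Topology MeasureTheory in
/-- Bessel's inequality on the circle, comparing a power series with a polynomial. -/
lemma circle_bessel (d b : ℕ → ℂ) (m n : ℕ) (hd : Summable (fun k => ‖d k‖))
    (hle : ∀ z : ℂ, ‖z‖ = 1 → ∀ s : ℂ, HasSum (fun k => d k * z ^ k) s →
      ‖s‖ ≤ ‖∑ k ∈ Finset.range n, b k * z ^ k‖) :
    ∑ k ∈ Finset.range m, ‖d k‖ ^ 2 ≤ ∑ k ∈ Finset.range n, ‖b k‖ ^ 2 := by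
  have : Fact ((0 : ℝ) < 1) := ⟨one_pos⟩
  let v : ℕ → Lp ℂ 2 (AddCircle.haarAddCircle (T := (1 : ℝ))) := fun k => fourierLp 2 (k : ℤ)
  have hv : Orthonormal ℂ v :=
    (orthonormal_fourier (T := (1 : ℝ))).comp (fun k : ℕ => (k : ℤ)) Nat.cast_injective
  have hfou : ∀ (k : ℕ) (t : AddCircle (1 : ℝ)),
      (fourier (k : ℤ) : C(AddCircle (1 : ℝ), ℂ)) t = (t.toCircle : ℂ) ^ k := by
    intro k t
    rw [fourier_apply, AddCircle.toCircle_zsmul]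
    simp
  have hsum : Summable (fun k : ℕ => d k • (fourier (k : ℤ) : C(AddCircle (1 : ℝ), ℂ))) := by
    apply Summable.of_norm
    refine hd.congr fun k => ?_
    rw [norm_smul, fourier_norm, mul_one]
  obtain ⟨F, hF⟩ := hsum
  let Q : C(AddCircle (1 : ℝ), ℂ) :=
    ∑ k ∈ Finset.range n, b k • (fourier (k : ℤ) : C(AddCircle (1 : ℝ), ℂ))
  let T := ContinuousMap.toLp (E := ℂ) 2 (AddCircle.haarAddCircle (T := (1 : ℝ))) ℂ
  have hTF : HasSum (fun k => d k • v k) (T F) := by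
    have := T.hasSum hF
    simpa [T, v, Function.comp_def] using this
  have hTQ : T Q = ∑ k ∈ Finset.range n, b k • v k := by
    simp [T, Q, v]
  have hpt : ∀ t, ‖F t‖ ≤ ‖Q t‖ := by
    intro t
    have h1 := ContinuousMap.hasSum_apply hF t
    have h2 := hle (t.toCircle : ℂ) (Circle.norm_coe _) (F t) (by
      simpa only [ContinuousMap.smul_apply, smul_eq_mul, hfou] using h1)
    refine h2.trans_eq ?_
    simp only [Q, ContinuousMap.coe_sum, Finset.sum_apply, ContinuousMap.coe_smul, Pi.smul_apply,
      smul_eq_mul, hfou]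
  have hnorm : ‖T F‖ ≤ ‖T Q‖ := by
    apply Lp.norm_le_norm_of_ae_le
    filter_upwards [ContinuousMap.coeFn_toLp (p := 2) (𝕜 := ℂ) AddCircle.haarAddCircle F,
      ContinuousMap.coeFn_toLp (p := 2) (𝕜 := ℂ) AddCircle.haarAddCircle Q] with t h1 h2
    simp only [T]
    rw [h1, h2]
    exact hpt t
  have hinner : ∀ k, inner ℂ (v k) (T F) = d k := by
    intro k
    have h1 := (innerSL ℂ (v k)).hasSum hTF
    have h2 : HasSum (fun j => innerSL ℂ (v k) (d j • v j)) (d k) := by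
      have : (fun j => innerSL ℂ (v k) (d j • v j)) = fun j => if j = k then d k else 0 := by
        funext j
        rw [innerSL_apply_apply, inner_smul_right, orthonormal_iff_ite.mp hv k j]
        by_cases h : j = k
        · simp [h]
        · simp [h, Ne.symm h]
      rw [this]
      exact hasSum_ite_eq k (d k)
    exact h1.unique h2
  have hQn : ‖T Q‖ ^ 2 = ∑ k ∈ Finset.range n, ‖b k‖ ^ 2 := by
    have h1 := hv.inner_sum b b (Finset.range n)
    rw [← hTQ, inner_self_eq_norm_sq_to_K] at h1
    simp only [RCLike.conj_mul] at h1
    exact_mod_cast h1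
  have hB := hv.sum_inner_products_le (T F) (s := Finset.range m)
  simp only [hinner] at hB
  calc _ ≤ ‖T F‖ ^ 2 := hB
    _ ≤ ‖T Q‖ ^ 2 := by gcongr
    _ = _ := hQn

/-- Taylor expansion at the origin with coefficients. -/
lemma taylor_hasSum {g : ℂ → ℂ} (hg : DifferentiableOn ℂ g (ball 0 1)) {z : ℂ}
    (hz : z ∈ ball (0 : ℂ) 1) :
    HasSum (fun n : ℕ => ((n.factorial : ℂ)⁻¹ * iteratedDeriv n g 0) * z ^ n) (g z) := by
  have := Complex.hasSum_taylorSeries_on_ball hg hz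
  refine hasSum_cast this (fun n => ?_) rfl
  simp only [sub_zero, smul_eq_mul]
  ring

lemma coeff_unique {g : ℂ → ℂ} {a b : ℕ → ℂ}
    (ha : ∀ z ∈ ball (0 : ℂ) 1, HasSum (fun n : ℕ => a n * z ^ n) (g z))
    (hb : ∀ z ∈ ball (0 : ℂ) 1, HasSum (fun n : ℕ => b n * z ^ n) (g z)) : a = b := by
  have key : ∀ c : ℕ → ℂ, (∀ z ∈ ball (0 : ℂ) 1, HasSum (fun n : ℕ => c n * z ^ n) (g z)) →
      HasFPowerSeriesAt g (FormalMultilinearSeries.ofScalars ℂ c) 0 := by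
    intro c hc
    rw [hasFPowerSeriesAt_iff]
    filter_upwards [ball_mem_nhds (0 : ℂ) one_pos] with z hz
    simp only [FormalMultilinearSeries.coeff_ofScalars, smul_eq_mul, zero_add]
    simpa only [mul_comm] using hc z hz
  have h := (key a ha).eq_formalMultilinearSeries (key b hb)
  funext n
  have := congrArg (fun p => FormalMultilinearSeries.coeff p n) h
  simpa only [FormalMultilinearSeries.coeff_ofScalars] using this

lemma hasSum_deriv {g : ℂ → ℂ} (hg : DifferentiableOn ℂ g (ball 0 1)) {a : ℕ → ℂ}
    (ha : ∀ z ∈ ball (0 : ℂ) 1, HasSum (fun n : ℕ => a n * z ^ n) (g z)) {z : ℂ}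
    (hz : z ∈ ball (0 : ℂ) 1) :
    HasSum (fun n : ℕ => ((n : ℂ) * a n) * z ^ n) (z * deriv g z) := by
  have h1 := coeff_unique ha (fun z hz => taylor_hasSum hg hz)
  have h2 := (taylor_hasSum (hg.deriv isOpen_ball) hz).mul_left z
  have h3 := (hasSum_nat_add_iff (f := fun n : ℕ => ((n : ℂ) * a n) * z ^ n)
    (g := z * deriv g z) 1).mp (by
      refine hasSum_cast h2 (fun n => ?_) rfl
      rw [h1, ← iteratedDeriv_succ']
      have : ((n : ℂ) + 1) ≠ 0 := by exact_mod_cast Nat.succ_ne_zero n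
      have : (n.factorial : ℂ) ≠ 0 := by exact_mod_cast n.factorial_ne_zero
      simp only [Nat.factorial_succ]
      push_cast
      field_simp
      ring)
  simpa using h3

open Filter Topology in
/-- Clunie's method. -/
lemma clunie {ω φ : ℂ → ℂ} (hω : DifferentiableOn ℂ ω (ball 0 1))
    (hω1 : ∀ z ∈ ball (0 : ℂ) 1, ‖ω z‖ ≤ 1) {b c : ℕ → ℂ}
    (hb : ∀ z ∈ ball (0 : ℂ) 1, HasSum (fun n : ℕ => b n * z ^ n) (φ z))
    (hc : ∀ z ∈ ball (0 : ℂ) 1, HasSum (fun n : ℕ => c n * z ^ n) (z * ω z * φ z)) (n : ℕ) :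
    ∑ k ∈ Finset.range (n + 1), ‖c k‖ ^ 2 ≤ ∑ k ∈ Finset.range n, ‖b k‖ ^ 2 := by
  obtain ⟨w, hw⟩ : ∃ w : ℕ → ℂ, ∀ z ∈ ball (0 : ℂ) 1,
      HasSum (fun n : ℕ => w n * z ^ n) (ω z) := ⟨_, fun z hz => taylor_hasSum hω hz⟩
  let e : ℕ → ℂ := fun k => ∑ p ∈ Finset.HasAntidiagonal.antidiagonal k, w p.1 * b (p.2 + n)
  let u : ℕ → ℂ := fun k => if n + 1 ≤ k then e (k - (n + 1)) else 0
  have hR : ∀ z ∈ ball (0 : ℂ) 1, HasSum (fun k : ℕ => e k * z ^ k * z ^ (n + 1))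
      (z * ω z * (φ z - ∑ k ∈ Finset.range n, b k * z ^ k)) := by
    intro z hz
    by_cases hz0 : z = 0
    · subst hz0
      simp
    have h1 := (hasSum_nat_add_iff' n).mpr (hb z hz)
    have h2 : HasSum (fun k => b (k + n) * z ^ k)
        ((φ z - ∑ k ∈ Finset.range n, b k * z ^ k) / z ^ n) := by
      refine hasSum_cast (h1.div_const (z ^ n)) (fun k => ?_) rfl
      field_simp
      ring
    have h3 := hw z hz
    have h4 := summable_norm_sum_mul_antidiagonal_of_summable_norm h3.summable.norm h2.summable.norm
    have h5 := tsum_mul_tsum_eq_tsum_sum_antidiagonal_of_summable_norm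
      h3.summable.norm h2.summable.norm
    have h6 := h4.of_norm.hasSum
    rw [← h5, h3.tsum_eq, h2.tsum_eq] at h6
    refine hasSum_cast (h6.mul_right (z ^ (n + 1))) (fun k => ?_) ?_
    · congr 1
      simp only [e, Finset.sum_mul]
      refine Finset.sum_congr rfl fun p hp => ?_
      rw [← Finset.HasAntidiagonal.mem_antidiagonal.mp hp, pow_add]
      ring
    · field_simp
      ring
  have hu : ∀ z ∈ ball (0 : ℂ) 1, HasSum (fun k : ℕ => u k * z ^ k)
      (z * ω z * (φ z - ∑ k ∈ Finset.range n, b k * z ^ k)) := by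
    intro z hz
    have h := (hasSum_nat_add_iff (f := fun k : ℕ => u k * z ^ k) (n + 1)).mp (by
      refine hasSum_cast (hR z hz) (fun k => ?_) rfl
      simp only [u]
      rw [if_pos (by omega), Nat.add_sub_cancel, pow_add z k, mul_assoc])
    have h0 : ∑ i ∈ Finset.range (n + 1), u i * z ^ i = 0 := by
      refine Finset.sum_eq_zero fun i hi => ?_
      have := Finset.mem_range.mp hi
      simp only [u]
      rw [if_neg (by omega), zero_mul]
    rwa [h0, add_zero] at h
  let d : ℕ → ℂ := fun k => c k - u k
  have hdc : ∀ k ∈ Finset.range (n + 1), d k = c k := by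
    intro k hk
    have := Finset.mem_range.mp hk
    simp only [d, u]
    rw [if_neg (by omega), sub_zero]
  have hd : ∀ z ∈ ball (0 : ℂ) 1, HasSum (fun k : ℕ => d k * z ^ k)
      (z * ω z * ∑ k ∈ Finset.range n, b k * z ^ k) := by
    intro z hz
    refine hasSum_cast ((hc z hz).sub (hu z hz)) (fun k => ?_) ?_
    · simp only [d]
      ring
    · ring
  have hr : ∀ r : ℝ, 0 < r → r < 1 →
      ∑ k ∈ Finset.range (n + 1), ‖c k‖ ^ 2 * (r ^ k) ^ 2
        ≤ ∑ k ∈ Finset.range n, ‖b k‖ ^ 2 * (r ^ k) ^ 2 := by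
    intro r hr0 hr1
    have hnr : ∀ (x : ℂ) (k : ℕ), ‖x * (r : ℂ) ^ k‖ ^ 2 = ‖x‖ ^ 2 * (r ^ k) ^ 2 := by
      intro x k
      rw [norm_mul, norm_pow, Complex.norm_real, Real.norm_of_nonneg hr0.le, mul_pow]
    have hB := circle_bessel (fun k => d k * (r : ℂ) ^ k) (fun k => b k * (r : ℂ) ^ k) (n + 1) n
      (hd (r : ℂ) (by simpa [abs_of_pos hr0] using hr1)).summable.norm (by
        intro z hz s hs
        have hn : ‖(r : ℂ) * z‖ = r := by
          rw [norm_mul, hz, mul_one, Complex.norm_real, Real.norm_of_nonneg hr0.le]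
        have hzb : (r : ℂ) * z ∈ ball (0 : ℂ) 1 := by
          rw [mem_ball_zero_iff, hn]; exact hr1
        have h1 := hd _ hzb
        simp only [mul_pow, ← mul_assoc] at h1
        rw [hs.unique h1]
        simp only [norm_mul _ (∑ k ∈ _, _)]
        refine mul_le_of_le_one_left (norm_nonneg _) ?_
        rw [mul_assoc, ← mul_assoc, norm_mul, hn]
        exact mul_le_one₀ hr1.le (norm_nonneg _) (hω1 _ hzb))
    simp only [hnr] at hB
    refine le_trans (le_of_eq ?_) hB
    exact Finset.sum_congr rfl fun k hk => by rw [hdc k hk]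
  have hcont : ∀ (x : ℕ → ℂ) (m : ℕ), Tendsto
      (fun r : ℝ => ∑ k ∈ Finset.range m, ‖x k‖ ^ 2 * (r ^ k) ^ 2) (𝓝[<] 1)
      (𝓝 (∑ k ∈ Finset.range m, ‖x k‖ ^ 2)) := by
    intro x m
    have : Continuous (fun r : ℝ => ∑ k ∈ Finset.range m, ‖x k‖ ^ 2 * (r ^ k) ^ 2) := by fun_prop
    have h := (this.tendsto 1).mono_left (nhdsWithin_le_nhds (s := Set.Iio 1))
    simpa using h
  refine le_of_tendsto_of_tendsto (hcont c (n + 1)) (hcont b n) ?_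
  filter_upwards [Ioo_mem_nhdsLT (zero_lt_one' ℝ)] with r hr'
  exact hr r hr'.1 hr'.2

theorem coeff_bound_small_lambda (A B lam : ℝ) (hB : -1 ≤ B) (hBA : B < A) (hA : A ≤ 1)
    (hlam0 : 0 < lam) (hlam1 : lam ≤ 1)
    (f : ℂ → ℂ) (hf : IsJanowskiStarlike A B f)
    (a : ℕ → ℂ) (ha : NegPowCoeff lam f a) (l : ℕ) (hl : 1 ≤ l) :
    ‖a l‖ ≤ lam * (A - B) / l := by
  obtain ⟨-, -, -, ω, hω, hω1, heq⟩ := hf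
  obtain ⟨h, hh, -, hfh, ha0, hsum⟩ := ha
  have hhd : DifferentiableOn ℂ h (ball 0 1) := hh.differentiableOn
  let g : ℂ → ℂ := fun z => Complex.exp (-(lam : ℂ) * h z)
  have hg : DifferentiableOn ℂ g (ball 0 1) := (hhd.const_mul _).cexp
  have hg' := fun z (hz : z ∈ ball (0 : ℂ) 1) => hasSum_deriv (g := g) hg hsum hz
  let β : ℕ → ℝ := fun k => lam * (A - B) + B * k
  let b : ℕ → ℂ := fun k => -(β k : ℂ) * a k
  have hode : ∀ z ∈ ball (0 : ℂ) 1, z * deriv g z =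
      z * ω z * (-((lam * (A - B) : ℂ) * g z + B * (z * deriv g z))) := by
    intro z hz
    have hz' := isOpen_ball.mem_nhds hz
    have hhz : HasDerivAt h (deriv h z) z := (hhd.differentiableAt hz').hasDerivAt
    have hgz : deriv g z = g z * (-(lam : ℂ) * deriv h z) := (hhz.const_mul _).cexp.deriv
    have hfz : deriv f z = Complex.exp (h z) + z * (Complex.exp (h z) * deriv h z) := by
      have : f =ᶠ[nhds z] fun z => z * Complex.exp (h z) := by
        filter_upwards [hz'] with y hy using hfh y hy
      have h3 := ((hasDerivAt_id z).mul hhz.cexp).deriv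
      rw [this.deriv_eq]
      refine h3.trans ?_
      simp
    by_cases hz0 : z = 0
    · simp [hz0]
    have hE := heq z hz
    rw [hfz, hfh z hz] at hE
    have hne : z * Complex.exp (h z) ≠ 0 := mul_ne_zero hz0 (Complex.exp_ne_zero _)
    have hE2 : (1 + z * deriv h z) * (1 + B * z * ω z) = 1 + A * z * ω z := by
      apply mul_left_cancel₀ hne
      linear_combination hE
    rw [hgz]
    linear_combination (-(lam : ℂ) * g z) * hE2
  have hb : ∀ z ∈ ball (0 : ℂ) 1, HasSum (fun n : ℕ => b n * z ^ n)
      (-((lam * (A - B) : ℂ) * g z + B * (z * deriv g z))) := by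
    intro z hz
    refine hasSum_cast (((hsum z hz).mul_left (lam * (A - B) : ℂ)).add
      ((hg' z hz).mul_left (B : ℂ))).neg (fun k => ?_) rfl
    simp only [b, β]
    push_cast
    ring
  have hmain := clunie hω.differentiableOn hω1 hb
    (c := fun n => (n : ℂ) * a n) (fun z hz => by rw [← hode z hz]; exact hg' z hz) l
  have hbk : ∀ k, 1 ≤ k → ‖b k‖ ^ 2 ≤ ‖(k : ℂ) * a k‖ ^ 2 := by
    intro k hk
    have hk' : (1 : ℝ) ≤ k := by exact_mod_cast hk
    have : |β k| ≤ k := by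
      rw [abs_le]
      simp only [β]
      constructor
      · nlinarith [mul_pos hlam0 (sub_pos.mpr hBA)]
      · nlinarith [mul_nonneg (sub_nonneg.mpr hlam1) (sub_pos.mpr hBA).le]
    simp only [b]
    rw [norm_mul, norm_mul, norm_neg, Complex.norm_real, Complex.norm_natCast, Real.norm_eq_abs]
    gcongr
  obtain ⟨m, rfl⟩ : ∃ m, l = m + 1 := ⟨l - 1, by omega⟩
  rw [Finset.sum_range_succ, Finset.sum_range_succ', Finset.sum_range_succ'] at hmain
  have hs : ∑ k ∈ Finset.range m, ‖b (k + 1)‖ ^ 2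
      ≤ ∑ k ∈ Finset.range m, ‖((k + 1 : ℕ) : ℂ) * a (k + 1)‖ ^ 2 :=
    Finset.sum_le_sum fun k _ => hbk (k + 1) (by omega)
  have hb0 : ‖b 0‖ = lam * (A - B) := by
    simp only [b, β, ha0]
    rw [norm_mul, norm_neg, Complex.norm_real, norm_one, Real.norm_eq_abs]
    simp [abs_of_pos (mul_pos hlam0 (sub_pos.mpr hBA))]
  have hpos : 0 ≤ lam * (A - B) := (mul_pos hlam0 (sub_pos.mpr hBA)).le
  have hfin : ‖((m + 1 : ℕ) : ℂ) * a (m + 1)‖ ^ 2 ≤ (lam * (A - B)) ^ 2 := by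
    rw [← hb0]
    have : 0 ≤ ‖((0 : ℕ) : ℂ) * a 0‖ ^ 2 := by positivity
    linarith
  have hfin2 := (sq_le_sq₀ (norm_nonneg _) hpos).mp hfin
  rw [norm_mul, Complex.norm_natCast] at hfin2
  rw [le_div_iff₀ (by positivity)]
  linarith
end

section
/- Let -1 ≤ B < A ≤ 1, λ > 1, δ = (1-A)/(1-B), and suppose δ lies in [(λ-[λ]+k)/λ, (λ-[λ]+k+1)/λ) for some k ∈ {0,...,[λ]-1}, with λ(1-δ) not an integer. If f ∈ S*(A,B) and (f(z)/z)^{-λ} = 1 + Σ_{n≥1} a_n(-λ,f) zⁿ, then |a_l(-λ,f)| ≤ (([λ]-k)/l) · Π_{j=0}^{[λ]-k-1} (λ(A-B)+Bj)/(j+1) for every l ≥ [λ]-k+1. -/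
open Metric Complex

lemma aux_ps_diff (c : ℕ → ℂ)
    (hc : ∀ z ∈ ball (0 : ℂ) 1, Summable (fun n : ℕ => c n * z ^ n)) :
    DifferentiableOn ℂ (fun z : ℂ => ∑' n : ℕ, c n * z ^ n) (ball 0 1) := by
  set p := FormalMultilinearSeries.ofScalars ℂ c with hp
  have hr : (1 : ENNReal) ≤ p.radius := by
    refine ENNReal.le_of_forall_nnreal_lt fun r hr => ?_
    have hr1 : (r : ℝ) < 1 := by exact_mod_cast hr
    have hs := hc (r : ℂ) (by simpa [abs_of_nonneg r.2] using hr1)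
    have ht := hs.tendsto_atTop_zero.norm
    refine p.le_radius_of_tendsto (l := 0) ?_
    convert ht using 2 with n
    · rw [hp, FormalMultilinearSeries.ofScalars_norm]
      simp
    · simp
  have h := (p.hasFPowerSeriesOnBall (lt_of_lt_of_le one_pos hr)).differentiableOn
  have h2 : DifferentiableOn ℂ p.sum (ball 0 1) := by
    refine h.mono ?_
    intro z hz
    simp only [Metric.mem_eball, edist_zero_right, mem_ball, dist_zero_right] at *
    refine lt_of_lt_of_le ?_ hr
    rw [← ofReal_norm, ENNReal.ofReal_lt_one]
    exact hz
  refine h2.congr fun z _ => ?_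
  rw [FormalMultilinearSeries.sum]
  refine tsum_congr fun n => ?_
  rw [hp, FormalMultilinearSeries.ofScalars_apply_eq]
  simp

lemma aux_remainder (a : ℕ → ℂ) (g : ℂ → ℂ)
    (hg : ∀ z ∈ ball (0 : ℂ) 1, HasSum (fun n : ℕ => a n * z ^ n) (g z)) (N : ℕ) :
    ∃ R : ℂ → ℂ, DifferentiableOn ℂ R (ball 0 1) ∧ ∀ z ∈ ball (0 : ℂ) 1,
      g z = ∑ n ∈ Finset.range N, a n * z ^ n + z ^ N * R z := by
  have hs : ∀ z ∈ ball (0 : ℂ) 1, Summable (fun n : ℕ => a (n + N) * z ^ n) := by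
    intro z hz
    by_cases h0 : z = 0
    · subst h0
      refine summable_of_ne_finset_zero (s := {0}) ?_
      intro n hn
      have : n ≠ 0 := by simpa using hn
      simp [this]
    · have h1 := ((summable_nat_add_iff N).2 (hg z hz).summable).mul_left ((z ^ N)⁻¹)
      refine h1.congr fun n => ?_
      have : z ^ N ≠ 0 := pow_ne_zero _ h0
      field_simp
      ring
  refine ⟨_, aux_ps_diff _ hs, fun z hz => ?_⟩
  rw [← (hg z hz).tsum_eq, ← (hg z hz).summable.sum_add_tsum_nat_add N, ← tsum_mul_left]
  congr 1
  refine tsum_congr fun n => ?_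
  ring

/-- orthogonality -/
lemma aux_orth (r : ℝ) (h0 : 0 < r) (h1 : r < 1) (c : ℕ → ℂ) (N : ℕ) (G : ℂ → ℂ)
    (hG : DifferentiableOn ℂ G (ball 0 1)) :
    Real.circleAverage (fun z => ‖∑ n ∈ Finset.range N, c n * z ^ n + z ^ N * G z‖ ^ 2) 0 r
      = Real.circleAverage (fun z => ‖∑ n ∈ Finset.range N, c n * z ^ n‖ ^ 2) 0 r
        + Real.circleAverage (fun z => ‖z ^ N * G z‖ ^ 2) 0 r := by
  have hsub : closedBall (0 : ℂ) r ⊆ ball 0 1 := closedBall_subset_ball h1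
  have hsub' : sphere (0 : ℂ) |r| ⊆ ball 0 1 := by
    rw [abs_of_pos h0]; exact sphere_subset_closedBall.trans hsub
  set Q : ℂ → ℂ := fun z => ∑ n ∈ Finset.range N, c n * z ^ n with hQ
  set H : ℂ → ℂ := fun z => ∑ n ∈ Finset.range N,
    (starRingEnd ℂ (c n) * (r : ℂ) ^ (2 * n)) * z ^ (N - n) * G z with hH
  have hHd : DifferentiableOn ℂ H (ball 0 1) := by
    rw [hH]
    fun_prop
  have hHavg : Real.circleAverage H 0 r = 0 := by
    have : DiffContOnCl ℂ H (ball 0 |r|) := by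
      rw [abs_of_pos h0]
      refine DifferentiableOn.diffContOnCl ?_
      rw [closure_ball _ h0.ne']
      exact hHd.mono hsub
    rw [this.circleAverage, hH]
    refine Finset.sum_eq_zero fun n hn => ?_
    have : N - n ≠ 0 := by have := Finset.mem_range.1 hn; omega
    simp [this]
  have hHi : CircleIntegrable H 0 r :=
    ((hHd.continuousOn.mono hsub').circleIntegrable' )
  have hre : Real.circleAverage (fun z => (H z).re) 0 r = 0 := by
    have := Complex.reCLM.circleAverage_comp_comm hHi
    rw [hHavg] at this
    simpa [Function.comp_def] using this
  have hGc := hG.continuousOn.mono hsub'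
  have hQc : Continuous Q := by rw [hQ]; fun_prop
  have hi1 : CircleIntegrable (fun z => ‖Q z‖ ^ 2) 0 r := by
    apply ContinuousOn.circleIntegrable'; fun_prop
  have hi2 : CircleIntegrable (fun z => ‖z ^ N * G z‖ ^ 2) 0 r := by
    apply ContinuousOn.circleIntegrable'; fun_prop
  have hi3 : CircleIntegrable (fun z => (H z).re) 0 r := by
    apply ContinuousOn.circleIntegrable'
    exact Complex.continuous_re.comp_continuousOn (hHd.continuousOn.mono hsub')
  have hi12 : CircleIntegrable (fun z => ‖Q z‖ ^ 2 + ‖z ^ N * G z‖ ^ 2) 0 r := hi1.add hi2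
  have hi4 : CircleIntegrable (fun z => (2:ℝ) • (H z).re) 0 r := by
    apply ContinuousOn.circleIntegrable'
    exact continuousOn_const.mul
      (Complex.continuous_re.comp_continuousOn (hHd.continuousOn.mono hsub'))
  have key : Set.EqOn (fun z => ‖Q z + z ^ N * G z‖ ^ 2)
      (fun z => (‖Q z‖ ^ 2 + ‖z ^ N * G z‖ ^ 2) + (2:ℝ) • (H z).re) (sphere 0 |r|) := by
    intro z hz
    have hzr : ‖z‖ = r := by simpa [abs_of_pos h0] using hz
    have hzz : (r : ℂ) ^ 2 = z * starRingEnd ℂ z := by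
      rw [Complex.mul_conj, Complex.normSq_eq_norm_sq, hzr]; push_cast; rfl
    have hHz : H z = starRingEnd ℂ (Q z) * (z ^ N * G z) := by
      simp only [hH, hQ, map_sum, Finset.sum_mul, map_mul, map_pow]
      refine Finset.sum_congr rfl fun n hn => ?_
      have hn' : N = n + (N - n) := by have := Finset.mem_range.1 hn; omega
      rw [pow_mul, hzz]
      conv_rhs => rw [hn', pow_add]
      ring
    simp only [hHz, ← Complex.normSq_eq_norm_sq, smul_eq_mul]
    rw [Complex.normSq_add]
    congr 2
    rw [← Complex.conj_re (Q z * _)]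
    simp
  rw [Real.circleAverage_congr_sphere key, Real.circleAverage_fun_add hi12 hi4,
    Real.circleAverage_fun_add hi1 hi2, Real.circleAverage_fun_smul, hre,
    smul_zero, add_zero]

lemma aux_parseval (r : ℝ) (h0 : 0 < r) (h1 : r < 1) (c : ℕ → ℂ) (N : ℕ) :
    Real.circleAverage (fun z => ‖∑ n ∈ Finset.range N, c n * z ^ n‖ ^ 2) 0 r
      = ∑ n ∈ Finset.range N, ‖c n‖ ^ 2 * r ^ (2 * n) := by
  induction N with
  | zero => simp [Real.circleAverage_const]
  | succ N ih =>
    rw [Finset.sum_range_succ, ← ih]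
    have := aux_orth r h0 h1 c N (fun _ => c N) (differentiableOn_const _)
    simp only [Finset.sum_range_succ]
    simp only [mul_comm _ (c N)] at this
    rw [this]
    congr 1
    refine Real.circleAverage_const_on_circle fun z hz => ?_
    have hzr : ‖z‖ = r := by simpa [abs_of_pos h0] using hz
    rw [norm_mul, norm_pow, hzr]
    ring

lemma aux_clunie (a : ℕ → ℂ) (g ω : ℂ → ℂ) (μ B : ℝ)
    (hgd : DifferentiableOn ℂ g (ball 0 1))
    (hωd : DifferentiableOn ℂ ω (ball 0 1)) (hω : ∀ z ∈ ball (0 : ℂ) 1, ‖ω z‖ ≤ 1)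
    (hg : ∀ z ∈ ball (0 : ℂ) 1, HasSum (fun n : ℕ => a n * z ^ n) (g z))
    (heq : ∀ z ∈ ball (0 : ℂ) 1,
      z * deriv g z = - (z * ω z) * (μ * g z + B * (z * deriv g z))) (N : ℕ) :
    ∑ n ∈ Finset.range (N + 1), (n : ℝ) ^ 2 * ‖a n‖ ^ 2
      ≤ ∑ n ∈ Finset.range N, (μ + B * n) ^ 2 * ‖a n‖ ^ 2 := by
  have hder : ∀ M : ℕ, ∃ R E : ℂ → ℂ, DifferentiableOn ℂ R (ball 0 1) ∧
      DifferentiableOn ℂ E (ball 0 1) ∧ ∀ z ∈ ball (0 : ℂ) 1,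
      g z = ∑ n ∈ Finset.range M, a n * z ^ n + z ^ M * R z ∧
      z * deriv g z = ∑ n ∈ Finset.range M, (n * a n) * z ^ n + z ^ M * E z := by
    intro M
    obtain ⟨R, hR, hRe⟩ := aux_remainder a g hg M
    refine ⟨R, fun z => M * R z + z * deriv R z, hR, ?_, fun z hz => ⟨hRe z hz, ?_⟩⟩
    · have := hR.deriv isOpen_ball
      fun_prop
    · have hev : g =ᶠ[nhds z] fun z => ∑ n ∈ Finset.range M, a n * z ^ n + z ^ M * R z :=
        Filter.eventuallyEq_of_mem (isOpen_ball.mem_nhds hz) hRe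
      have hRz : HasDerivAt R (deriv R z) z :=
        (hR.differentiableAt (isOpen_ball.mem_nhds hz)).hasDerivAt
      have h1 : HasDerivAt (fun z : ℂ => ∑ n ∈ Finset.range M, a n * z ^ n + z ^ M * R z)
          (∑ n ∈ Finset.range M, a n * (n * z ^ (n - 1))
            + (M * z ^ (M - 1) * R z + z ^ M * deriv R z)) z := by
        refine HasDerivAt.add ?_ ((hasDerivAt_pow M z).mul hRz)
        refine HasDerivAt.fun_sum fun n _ => ?_
        exact (hasDerivAt_pow n z).const_mul _
      have hp : ∀ n : ℕ, z * ((n : ℂ) * z ^ (n - 1)) = n * z ^ n := by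
        intro n
        cases n with
        | zero => simp
        | succ n => simp only [Nat.add_sub_cancel]; ring
      rw [hev.deriv_eq, h1.deriv, mul_add, Finset.mul_sum]
      congr 1
      · refine Finset.sum_congr rfl fun n _ => ?_
        linear_combination a n * hp n
      · linear_combination R z * hp M
  obtain ⟨_, E1, -, hE1, h1⟩ := hder (N + 1)
  obtain ⟨R2, E2, hR2, hE2, h2⟩ := hder N
  have hrr : ∀ r ∈ Set.Ioo (0 : ℝ) 1,
      ∑ n ∈ Finset.range (N + 1), (n : ℝ) ^ 2 * ‖a n‖ ^ 2 * r ^ (2 * n)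
      ≤ ∑ n ∈ Finset.range N, (μ + B * n) ^ 2 * ‖a n‖ ^ 2 * r ^ (2 * n) := by
    intro r ⟨h0, hr1⟩
    have hsub' : sphere (0 : ℂ) |r| ⊆ ball 0 1 := by
      rw [abs_of_pos h0]; exact sphere_subset_closedBall.trans (closedBall_subset_ball hr1)
    set G : ℂ → ℂ := fun z => E1 z + ω z * (μ * R2 z + B * E2 z) with hGdef
    have hG : DifferentiableOn ℂ G (ball 0 1) := by rw [hGdef]; fun_prop
    have hGc := hG.continuousOn.mono hsub'
    have o := aux_orth r h0 hr1 (fun n => n * a n) (N + 1) G hG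
    rw [aux_parseval r h0 hr1] at o
    have p := aux_parseval r h0 hr1 (fun n => ((μ : ℂ) + B * n) * a n) N
    have hnn : 0 ≤ Real.circleAverage (fun z => ‖z ^ (N + 1) * G z‖ ^ 2) 0 r :=
      Real.circleAverage_nonneg_of_nonneg fun z _ => by positivity
    have hle : Real.circleAverage (fun z => ‖∑ n ∈ Finset.range (N + 1), (n * a n) * z ^ n
        + z ^ (N + 1) * G z‖ ^ 2) 0 r ≤ Real.circleAverage
        (fun z => ‖∑ n ∈ Finset.range N, (((μ : ℂ) + B * n) * a n) * z ^ n‖ ^ 2) 0 r := by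
      refine Real.circleAverage_mono ?_ ?_ ?_
      · apply ContinuousOn.circleIntegrable'; fun_prop
      · apply ContinuousOn.circleIntegrable'; fun_prop
      · intro z hz
        have hzb := hsub' hz
        have e : ∑ n ∈ Finset.range (N + 1), (n * a n) * z ^ n + z ^ (N + 1) * G z
            = -(z * ω z) * ∑ n ∈ Finset.range N, (((μ : ℂ) + B * n) * a n) * z ^ n := by
          have e0 := heq z hzb
          have e1 := (h1 z hzb).2
          obtain ⟨e2, e3⟩ := h2 z hzb
          have e4 : ∑ n ∈ Finset.range N, (((μ : ℂ) + B * n) * a n) * z ^ n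
            = μ * ∑ n ∈ Finset.range N, a n * z ^ n
              + B * ∑ n ∈ Finset.range N, (n * a n) * z ^ n := by
            rw [Finset.mul_sum, Finset.mul_sum, ← Finset.sum_add_distrib]
            exact Finset.sum_congr rfl fun n _ => by ring
          rw [e4, hGdef]
          linear_combination e0 - e1 - (z * ω z) * (μ * e2 + B * e3)
        rw [e, norm_mul]
        have hz1 : ‖z‖ ≤ 1 := by
          have : ‖z‖ < 1 := by simpa using hzb
          exact this.le
        have : ‖-(z * ω z)‖ ≤ 1 := by
          rw [norm_neg, norm_mul]
          exact mul_le_one₀ hz1 (norm_nonneg _) (hω z hzb)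
        have h3 := mul_le_mul_of_nonneg_right this (norm_nonneg
          (∑ n ∈ Finset.range N, (((μ : ℂ) + B * n) * a n) * z ^ n))
        rw [one_mul] at h3
        exact pow_le_pow_left₀ (by positivity) h3 2
    have hle := (le_add_of_nonneg_right hnn).trans (o.symm.le.trans (hle.trans p.le))
    have hn : ∀ n : ℕ, ‖(μ : ℂ) + B * n‖ ^ 2 = (μ + B * n) ^ 2 := by
      intro n
      have : (μ : ℂ) + B * n = ((μ + B * n : ℝ) : ℂ) := by push_cast; rfl
      rw [this, Complex.norm_real, Real.norm_eq_abs, sq_abs]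
    simp only [norm_mul, mul_pow, hn, Complex.norm_natCast] at hle
    exact hle
  have hcl : Filter.Tendsto (fun r : ℝ => r) (nhdsWithin 1 (Set.Iio 1)) (nhds 1) :=
    Filter.tendsto_id.mono_left nhdsWithin_le_nhds
  have hev : ∀ᶠ r : ℝ in nhdsWithin 1 (Set.Iio 1), r ∈ Set.Ioo (0 : ℝ) 1 :=
    Ioo_mem_nhdsLT one_pos
  have t : ∀ (c : ℕ → ℝ) (M : ℕ), Filter.Tendsto
      (fun r : ℝ => ∑ n ∈ Finset.range M, c n * r ^ (2 * n)) (nhdsWithin 1 (Set.Iio 1))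
      (nhds (∑ n ∈ Finset.range M, c n)) := by
    intro c M
    have hc : Continuous (fun r : ℝ => ∑ n ∈ Finset.range M, c n * r ^ (2 * n)) := by fun_prop
    have := (hc.tendsto 1).mono_left (nhdsWithin_le_nhds (s := Set.Iio 1))
    simpa using this
  exact le_of_tendsto_of_tendsto (t _ _) (t _ _) (hev.mono hrr)

lemma aux_prod_sum (μ B : ℝ) (N : ℕ) :
    ∑ n ∈ Finset.range N, ((μ + B * n) ^ 2 - (n : ℝ) ^ 2) *
      (∏ j ∈ Finset.range n, (μ + B * j) / (j + 1)) ^ 2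
    = ((N : ℝ) * ∏ j ∈ Finset.range N, (μ + B * j) / (j + 1)) ^ 2 := by
  induction N with
  | zero => simp
  | succ N ih =>
    rw [Finset.sum_range_succ, ih, Finset.prod_range_succ]
    have : (N : ℝ) + 1 ≠ 0 := by positivity
    push_cast
    field_simp
    ring

lemma aux_bound (x : ℕ → ℝ) (μ B : ℝ) (m : ℕ) (hB : -1 ≤ B) (hμ : 0 < μ)
    (hx : ∀ n, 0 ≤ x n) (hx0 : x 0 = 1)
    (h1 : ∀ n < m, (1 - B) * n ≤ μ) (h2 : ∀ n, m ≤ n → μ ≤ (1 - B) * n)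
    (hC : ∀ N, ∑ n ∈ Finset.range (N + 1), (n : ℝ) ^ 2 * x n ^ 2
      ≤ ∑ n ∈ Finset.range N, (μ + B * n) ^ 2 * x n ^ 2) (l : ℕ) (hl : m < l) :
    x l ≤ (m : ℝ) / l * ∏ j ∈ Finset.range m, (μ + B * j) / (j + 1) := by
  have hC' : ∀ N : ℕ, ((N : ℝ) * x N) ^ 2 ≤ ∑ n ∈ Finset.range N,
      ((μ + B * n) ^ 2 - (n : ℝ) ^ 2) * x n ^ 2 := by
    intro N
    have := hC N
    rw [Finset.sum_range_succ] at this
    simp only [sub_mul, Finset.sum_sub_distrib]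
    linarith [mul_pow (N : ℝ) (x N) 2]
  set P : ℕ → ℝ := fun n => ∏ j ∈ Finset.range n, (μ + B * j) / (j + 1) with hP
  have hPn : ∀ n ≤ m, 0 ≤ P n := by
    intro n hn
    refine Finset.prod_nonneg fun j hj => ?_
    have hj' := Finset.mem_range.1 hj
    have := h1 j (by omega)
    have h0 : (0 : ℝ) ≤ j := by positivity
    exact div_nonneg (by linarith) (by positivity)
  have hs : ∀ n : ℕ, 0 ≤ μ + (1 + B) * n := fun n => by
    have : 0 ≤ (1 + B) * n := mul_nonneg (by linarith) (by positivity)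
    linarith
  have hfac : ∀ n : ℕ, (μ + B * n) ^ 2 - (n : ℝ) ^ 2
      = (μ - (1 - B) * n) * (μ + (1 + B) * n) := fun n => by ring
  have hcoef : ∀ n < m, 0 ≤ (μ + B * n) ^ 2 - (n : ℝ) ^ 2 := by
    intro n hn
    rw [hfac]
    exact mul_nonneg (by linarith [h1 n hn]) (hs n)
  have hcoef2 : ∀ n, m ≤ n → (μ + B * n) ^ 2 - (n : ℝ) ^ 2 ≤ 0 := by
    intro n hn
    rw [hfac]
    exact mul_nonpos_of_nonpos_of_nonneg (by linarith [h2 n hn]) (hs n)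
  have hbd : ∀ n, n < m → x n ≤ P n := by
    intro n
    induction n using Nat.strong_induction_on with
    | _ n ih =>
      intro hn
      rcases Nat.eq_zero_or_pos n with h | h
      · subst h; simp [hP, hx0]
      have h3 : ((n : ℝ) * x n) ^ 2 ≤ ((n : ℝ) * P n) ^ 2 := by
        refine (hC' n).trans ?_
        rw [hP, ← aux_prod_sum]
        refine Finset.sum_le_sum fun i hi => ?_
        have hi' := Finset.mem_range.1 hi
        exact mul_le_mul_of_nonneg_left
          (pow_le_pow_left₀ (hx i) (ih i hi' (by omega)) 2) (hcoef i (by omega))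
      have hn0 : (0 : ℝ) < n := by exact_mod_cast h
      have h4 := abs_le_of_sq_le_sq' h3 (mul_nonneg hn0.le (hPn n hn.le))
      exact le_of_mul_le_mul_left h4.2 hn0
  have h3 : ((l : ℝ) * x l) ^ 2 ≤ ((m : ℝ) * P m) ^ 2 := by
    refine (hC' l).trans ?_
    rw [hP, ← aux_prod_sum, ← Finset.sum_range_add_sum_Ico _ hl.le]
    have hneg : ∑ n ∈ Finset.Ico m l, ((μ + B * n) ^ 2 - (n : ℝ) ^ 2) * x n ^ 2 ≤ 0 :=
      Finset.sum_nonpos fun n hn => mul_nonpos_of_nonpos_of_nonneg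
        (hcoef2 n (Finset.mem_Ico.1 hn).1) (sq_nonneg _)
    have : ∑ n ∈ Finset.range m, ((μ + B * n) ^ 2 - (n : ℝ) ^ 2) * x n ^ 2 ≤
        ∑ n ∈ Finset.range m, ((μ + B * n) ^ 2 - (n : ℝ) ^ 2) * P n ^ 2 := by
      refine Finset.sum_le_sum fun i hi => ?_
      have hi' := Finset.mem_range.1 hi
      exact mul_le_mul_of_nonneg_left
        (pow_le_pow_left₀ (hx i) (hbd i hi') 2) (hcoef i hi')
    linarith
  have hl0 : (0 : ℝ) < l := by exact_mod_cast (by omega : 0 < l)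
  have h4 := (abs_le_of_sq_le_sq' h3 (mul_nonneg (by positivity) (hPn m le_rfl))).2
  rw [div_mul_eq_mul_div, le_div_iff₀ hl0]
  linarith

theorem coeff_bound_Ik_tail (A B lam δ : ℝ) (hB : -1 ≤ B) (hBA : B < A) (hA : A ≤ 1)
    (hlam : 1 < lam) (hδ : δ = (1 - A) / (1 - B))
    (k : ℕ) (hk : k ≤ ⌊lam⌋₊ - 1)
    (hδ1 : (lam - ⌊lam⌋₊ + k) / lam ≤ δ) (hδ2 : δ < (lam - ⌊lam⌋₊ + k + 1) / lam)
    (hnotint : ¬ ∃ m : ℤ, lam * (1 - δ) = m)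
    (f : ℂ → ℂ) (hf : IsJanowskiStarlike A B f)
    (a : ℕ → ℂ) (ha : NegPowCoeff lam f a)
    (l : ℕ) (hl : ⌊lam⌋₊ - k + 1 ≤ l) :
    ‖a l‖ ≤ ((⌊lam⌋₊ - k : ℕ) : ℝ) / l *
      ∏ j ∈ Finset.range (⌊lam⌋₊ - k), (lam * (A - B) + B * j) / (j + 1) := by
  obtain ⟨hfa, -, -, ω, hωa, hω, hfe⟩ := hf
  obtain ⟨h, hha, -, hfh, ha0, hg⟩ := ha
  have hfl : 1 ≤ ⌊lam⌋₊ := Nat.le_floor (by exact_mod_cast hlam.le)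
  have hkf : k ≤ ⌊lam⌋₊ := by omega
  have hmc : ((⌊lam⌋₊ - k : ℕ) : ℝ) = (⌊lam⌋₊ : ℝ) - k := by rw [Nat.cast_sub hkf]
  have hB1 : 0 < 1 - B := by linarith
  have hlam0 : 0 < lam := by linarith
  have hμ : 0 < lam * (A - B) := mul_pos hlam0 (by linarith)
  have hδμ : lam * (A - B) = (1 - B) * (lam * (1 - δ)) := by
    rw [hδ]; field_simp; ring
  rw [div_le_iff₀ hlam0] at hδ1
  rw [lt_div_iff₀ hlam0] at hδ2
  have hgd : DifferentiableOn ℂ (fun z => Complex.exp (-(lam : ℂ) * h z)) (ball 0 1) := by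
    have := hha.differentiableOn
    fun_prop
  have heq : ∀ z ∈ ball (0 : ℂ) 1,
      z * deriv (fun z => Complex.exp (-(lam : ℂ) * h z)) z = - (z * ω z) *
        ((lam * (A - B) : ℝ) * Complex.exp (-(lam : ℂ) * h z)
          + B * (z * deriv (fun z => Complex.exp (-(lam : ℂ) * h z)) z)) := by
    intro z hz
    by_cases hz0 : z = 0
    · simp [hz0]
    have hhz : HasDerivAt h (deriv h z) z :=
      (hha.differentiableOn.differentiableAt (isOpen_ball.mem_nhds hz)).hasDerivAt
    have hev : f =ᶠ[nhds z] fun z => z * Complex.exp (h z) :=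
      Filter.eventuallyEq_of_mem (isOpen_ball.mem_nhds hz) hfh
    have d1 : deriv f z = 1 * Complex.exp (h z) + z * (Complex.exp (h z) * deriv h z) := by
      rw [hev.deriv_eq]
      exact ((hasDerivAt_id z).mul hhz.cexp).deriv
    have d2 : deriv (fun z => Complex.exp (-(lam : ℂ) * h z)) z
        = Complex.exp (-(lam : ℂ) * h z) * (-(lam : ℂ) * deriv h z) :=
      (hhz.const_mul _).cexp.deriv
    have e := hfe z hz
    rw [hfh z hz, d1] at e
    have e2 : z * Complex.exp (h z) *
        ((z * deriv h z) * (1 + B * z * ω z) - ((A : ℂ) - B) * z * ω z) = 0 := by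
      linear_combination e
    have e3 := (mul_eq_zero.1 e2).resolve_left (mul_ne_zero hz0 (Complex.exp_ne_zero _))
    rw [d2]
    push_cast
    linear_combination (-(lam : ℂ) * Complex.exp (-(lam : ℂ) * h z)) * e3
  refine aux_bound (fun n => ‖a n‖) (lam * (A - B)) B (⌊lam⌋₊ - k) hB hμ
    (fun n => norm_nonneg _) (by simp [ha0]) ?_ ?_
    (aux_clunie a _ ω (lam * (A - B)) B hgd hωa.differentiableOn hω hg heq) l (by omega)
  · intro n hn
    have : (n : ℝ) + 1 ≤ ((⌊lam⌋₊ - k : ℕ) : ℝ) := by exact_mod_cast hn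
    rw [hδμ]
    refine mul_le_mul_of_nonneg_left ?_ hB1.le
    linarith
  · intro n hn
    have : ((⌊lam⌋₊ - k : ℕ) : ℝ) ≤ n := by exact_mod_cast hn
    rw [hδμ]
    refine mul_le_mul_of_nonneg_left ?_ hB1.le
    linarith
end

section
/- Let -1 ≤ B < A ≤ 1, λ > 1, δ = (1-A)/(1-B), and suppose 0 ≤ δ < (λ-[λ])/λ. If f ∈ S*(A,B) and (f(z)/z)^{-λ} = 1 + Σ_{n≥1} a_n(-λ,f) zⁿ, then |a_l(-λ,f)| ≤ Π_{j=0}^{l-1} (λ(A-B)+Bj)/(j+1) for l = 1, 2, ..., [λ]+1. -/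
open Metric Complex

/-- `φ` is the power series of `u` on the unit disk. -/
def RepSeries (φ : PowerSeries ℂ) (u : ℂ → ℂ) : Prop :=
  ∀ z ∈ ball (0 : ℂ) 1, HasSum (fun n : ℕ => PowerSeries.coeff n φ * z ^ n) (u z)

lemma RepSeries.mul {φ ψ : PowerSeries ℂ} {u v : ℂ → ℂ} (hφ : RepSeries φ u)
    (hψ : RepSeries ψ v) : RepSeries (φ * ψ) (fun z => u z * v z) := by
  intro z hz
  have h1 := hφ z hz
  have h2 := hψ z hz
  have h3 := summable_norm_sum_mul_antidiagonal_of_summable_norm h1.summable.norm h2.summable.norm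
  have h4 := tsum_mul_tsum_eq_tsum_sum_antidiagonal_of_summable_norm
    h1.summable.norm h2.summable.norm
  rw [h1.tsum_eq, h2.tsum_eq] at h4
  have h5 := h3.of_norm.hasSum
  rw [← h4] at h5
  refine Eq.mp (congrArg (fun s => HasSum s (u z * v z)) (funext fun n => ?_)) h5
  rw [PowerSeries.coeff_mul, Finset.sum_mul]
  symm
  refine Finset.sum_congr rfl fun p hp => ?_
  rw [← Finset.HasAntidiagonal.mem_antidiagonal.mp hp, pow_add]
  ring

lemma RepSeries.congr {φ : PowerSeries ℂ} {u v : ℂ → ℂ} (hφ : RepSeries φ u)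
    (h : ∀ z ∈ ball (0 : ℂ) 1, u z = v z) : RepSeries φ v := by
  intro z hz
  rw [← h z hz]
  exact hφ z hz

lemma RepSeries.add {φ ψ : PowerSeries ℂ} {u v : ℂ → ℂ} (hφ : RepSeries φ u)
    (hψ : RepSeries ψ v) : RepSeries (φ + ψ) (fun z => u z + v z) := by
  intro z hz
  simpa [add_mul] using (hφ z hz).add (hψ z hz)

lemma RepSeries.const_mul {φ : PowerSeries ℂ} {u : ℂ → ℂ} (c : ℂ) (hφ : RepSeries φ u) :
    RepSeries (PowerSeries.C c * φ) (fun z => c * u z) := by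
  intro z hz
  simpa [mul_assoc] using (hφ z hz).mul_left c

lemma repSeries_X : RepSeries PowerSeries.X (fun z => z) := by
  intro z hz
  have := hasSum_single (f := fun n : ℕ => PowerSeries.coeff n (PowerSeries.X : PowerSeries ℂ) * z ^ n) 1
    (by intro n hn; simp [PowerSeries.coeff_X, hn])
  simpa using this

lemma repSeries_trunc (n : ℕ) (φ : PowerSeries ℂ) :
    RepSeries (PowerSeries.trunc n φ : Polynomial ℂ)
      (fun z => ∑ k ∈ Finset.range n, PowerSeries.coeff k φ * z ^ k) := by
  intro z hz
  have := hasSum_sum_of_ne_finset_zero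
    (f := fun k : ℕ => PowerSeries.coeff k ((PowerSeries.trunc n φ : Polynomial ℂ) : PowerSeries ℂ) * z ^ k)
    (s := Finset.range n) (L := SummationFilter.unconditional ℕ) (by
      intro k hk
      simp only [Finset.mem_range] at hk
      simp [PowerSeries.coeff_trunc, hk])
  convert this using 1
  refine Finset.sum_congr rfl fun k hk => ?_
  simp only [Finset.mem_range] at hk
  simp [PowerSeries.coeff_trunc, hk]

lemma RepSeries.unique {φ ψ : PowerSeries ℂ} {u : ℂ → ℂ} (hφ : RepSeries φ u)
    (hψ : RepSeries ψ u) : φ = ψ := by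
  have key : ∀ χ : PowerSeries ℂ, RepSeries χ u → HasFPowerSeriesAt u
      (FormalMultilinearSeries.ofScalars ℂ (fun n => PowerSeries.coeff n χ)) 0 := by
    intro χ hχ
    rw [hasFPowerSeriesAt_iff]
    filter_upwards [ball_mem_nhds (0 : ℂ) one_pos] with z hz
    simpa [FormalMultilinearSeries.coeff_ofScalars, mul_comm] using hχ z hz
  have h := (key φ hφ).eq_formalMultilinearSeries (key ψ hψ)
  ext n
  have h2 := congrArg (fun p => FormalMultilinearSeries.coeff p n) h
  simpa [FormalMultilinearSeries.coeff_ofScalars] using h2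

lemma repSeries_taylor {u : ℂ → ℂ} (hu : DifferentiableOn ℂ u (ball 0 1)) :
    RepSeries (PowerSeries.mk fun n => ((n.factorial : ℂ))⁻¹ * iteratedDeriv n u 0) u := by
  intro z hz
  have := Complex.hasSum_taylorSeries_on_ball hu hz
  refine Eq.mp (congrArg (fun s => HasSum s (u z)) (funext fun n => ?_)) this
  simp only [sub_zero, smul_eq_mul, PowerSeries.coeff_mk]
  ring

lemma RepSeries.derivative {φ : PowerSeries ℂ} {u : ℂ → ℂ} (hu : DifferentiableOn ℂ u (ball 0 1))
    (hφ : RepSeries φ u) :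
    RepSeries (PowerSeries.mk fun n => ((n : ℂ) + 1) * PowerSeries.coeff (n + 1) φ) (deriv u) := by
  have h1 := hφ.unique (repSeries_taylor hu)
  have h2 := repSeries_taylor (hu.deriv isOpen_ball)
  convert h2 using 2
  funext n
  rw [h1, PowerSeries.coeff_mk, iteratedDeriv_succ', Nat.factorial_succ]
  have : (n.factorial : ℂ) ≠ 0 := by exact_mod_cast n.factorial_ne_zero
  have : (n : ℂ) + 1 ≠ 0 := by exact_mod_cast n.succ_ne_zero
  push_cast
  field_simp

lemma RepSeries.toL2 {φ : PowerSeries ℂ} {u : ℂ → ℂ} (hφ : RepSeries φ u) {r : ℝ} (h0 : 0 ≤ r)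
    (h1 : r < 1) :
    ∃ x : MeasureTheory.Lp ℂ 2 (@AddCircle.haarAddCircle 1 _),
      HasSum (fun k : ℕ => (PowerSeries.coeff k φ * (r : ℂ) ^ k) • fourierLp 2 (k : ℤ)) x ∧
      ∀ᵐ t ∂(@AddCircle.haarAddCircle 1 _), x t = u (r * fourier 1 t) := by
  have hr : (r : ℂ) ∈ ball (0 : ℂ) 1 := by simp [abs_of_nonneg h0, h1]
  have hs : Summable (fun k : ℕ => (PowerSeries.coeff k φ * (r : ℂ) ^ k) •
      (fourier (k : ℤ) : C(AddCircle (1 : ℝ), ℂ))) := by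
    apply Summable.of_norm
    have := (hφ r hr).summable.norm
    convert this using 2 with k
    rw [norm_smul, fourier_norm, mul_one]
  obtain ⟨g, hg⟩ := hs
  refine ⟨ContinuousMap.toLp 2 _ ℂ g, ?_, ?_⟩
  · have := hg.mapL (ContinuousMap.toLp 2 (@AddCircle.haarAddCircle 1 _) ℂ)
    simpa only [map_smul] using this
  · filter_upwards [ContinuousMap.coeFn_toLp (p := 2) (𝕜 := ℂ) (@AddCircle.haarAddCircle 1 _) g] with t ht
    rw [ht]
    have e1 := ContinuousMap.hasSum_apply hg t
    have hz : (r : ℂ) * fourier 1 t ∈ ball (0 : ℂ) 1 := by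
      rw [mem_ball_zero_iff, norm_mul, fourier_apply, Circle.norm_coe]
      simp [abs_of_nonneg h0, h1]
    refine e1.unique ?_
    convert hφ _ hz using 2 with k
    simp only [ContinuousMap.coe_smul, Pi.smul_apply, smul_eq_mul, mul_pow, mul_assoc]
    congr 2
    simp [fourier_apply, AddCircle.toCircle_nsmul]

lemma sum_sq_le_of_bound {φ ψ : PowerSeries ℂ} {u v : ℂ → ℂ} (hφ : RepSeries φ u)
    (hψ : RepSeries ψ v) (n : ℕ) (hn : ∀ k, n ≤ k → PowerSeries.coeff k ψ = 0)
    (hb : ∀ z ∈ ball (0 : ℂ) 1, ‖u z‖ ≤ ‖v z‖) :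
    ∑ k ∈ Finset.range n, ‖PowerSeries.coeff k φ‖ ^ 2 ≤
      ∑ k ∈ Finset.range n, ‖PowerSeries.coeff k ψ‖ ^ 2 := by
  have key : ∀ r : ℝ, 0 ≤ r → r < 1 →
      ∑ k ∈ Finset.range n, ‖PowerSeries.coeff k φ * (r : ℂ) ^ k‖ ^ 2 ≤
      ∑ k ∈ Finset.range n, ‖PowerSeries.coeff k ψ * (r : ℂ) ^ k‖ ^ 2 := by
    intro r h0 h1
    obtain ⟨x, hx, hxu⟩ := hφ.toL2 h0 h1
    obtain ⟨y, hy, hyv⟩ := hψ.toL2 h0 h1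
    have hxy : ‖x‖ ≤ ‖y‖ := by
      apply MeasureTheory.Lp.norm_le_norm_of_ae_le
      filter_upwards [hxu, hyv] with t h2 h3
      rw [h2, h3]
      apply hb
      rw [mem_ball_zero_iff, norm_mul, fourier_apply, Circle.norm_coe]
      simp [abs_of_nonneg h0, h1]
    have ho : Orthonormal ℂ (fun k : ℕ => (fourierLp 2 (k : ℤ) :
        MeasureTheory.Lp ℂ 2 (@AddCircle.haarAddCircle 1 _))) :=
      orthonormal_fourier.comp _ Nat.cast_injective
    have hxi : ∀ k : ℕ, inner ℂ (fourierLp 2 (k : ℤ)) x = PowerSeries.coeff k φ * (r : ℂ) ^ k := by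
      intro k
      have h2 := hx.mapL (innerSL ℂ (fourierLp 2 (k : ℤ)))
      have h3 := hasSum_single (f := fun j : ℕ => innerSL ℂ (fourierLp 2 (k : ℤ))
        ((PowerSeries.coeff j φ * (r : ℂ) ^ j) • (fourierLp 2 (j : ℤ) :
          MeasureTheory.Lp ℂ 2 (@AddCircle.haarAddCircle 1 _)))) k (by
          intro j hj
          have := ho.2 (Ne.symm hj)
          simp only [innerSL_apply_apply, inner_smul_right]
          simp only at this
          rw [this, mul_zero])
      have h4 := h2.unique h3
      simp only [innerSL_apply_apply, inner_smul_right] at h4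
      rw [h4, inner_self_eq_norm_sq_to_K, ho.1 k]
      simp
    have hys : y = ∑ k ∈ Finset.range n,
        (PowerSeries.coeff k ψ * (r : ℂ) ^ k) • fourierLp 2 (k : ℤ) := by
      refine hy.unique (hasSum_sum_of_ne_finset_zero ?_)
      intro k hk
      simp only [Finset.mem_range, not_lt] at hk
      simp [hn k hk]
    have hyn : ‖y‖ ^ 2 = ∑ k ∈ Finset.range n, ‖PowerSeries.coeff k ψ * (r : ℂ) ^ k‖ ^ 2 := by
      have h2 := ho.inner_sum (fun k => PowerSeries.coeff k ψ * (r : ℂ) ^ k)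
        (fun k => PowerSeries.coeff k ψ * (r : ℂ) ^ k) (Finset.range n)
      rw [← hys, inner_self_eq_norm_sq_to_K] at h2
      simp only [Complex.conj_mul'] at h2
      exact Complex.ofReal_injective (by push_cast; exact h2)
    have hB := ho.sum_inner_products_le (s := Finset.range n) x
    simp only [hxi] at hB
    rw [← hyn]
    exact hB.trans (by gcongr)
  have hc : ∀ χ : PowerSeries ℂ, Filter.Tendsto
      (fun r : ℝ => ∑ k ∈ Finset.range n, ‖PowerSeries.coeff k χ * (r : ℂ) ^ k‖ ^ 2)
      (nhdsWithin 1 (Set.Iio 1)) (nhds (∑ k ∈ Finset.range n, ‖PowerSeries.coeff k χ‖ ^ 2)) := by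
    intro χ
    have : Continuous (fun r : ℝ => ∑ k ∈ Finset.range n, ‖PowerSeries.coeff k χ * (r : ℂ) ^ k‖ ^ 2) := by
      fun_prop
    have h2 := this.tendsto 1
    simp only [Complex.ofReal_one, one_pow, mul_one] at h2
    exact h2.mono_left nhdsWithin_le_nhds
  refine le_of_tendsto_of_tendsto (hc φ) (hc ψ) ?_
  filter_upwards [Ioo_mem_nhdsLT (zero_lt_one' ℝ)] with r hr
  exact key r hr.1.le hr.2

/-- Clunie's inequality. -/
lemma clunie_s7 (A B lam : ℝ) (f : ℂ → ℂ) (hf : IsJanowskiStarlike A B f)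
    (a : ℕ → ℂ) (ha : NegPowCoeff lam f a) (n : ℕ) :
    ∑ k ∈ Finset.range n, ((k : ℝ) + 1) ^ 2 * ‖a (k + 1)‖ ^ 2 ≤
      ∑ k ∈ Finset.range n, (lam * (A - B) + B * k) ^ 2 * ‖a k‖ ^ 2 := by
  obtain ⟨-, -, -, ω, hω, hω1, hfe⟩ := hf
  obtain ⟨h, hh, hh0, hfh, ha0, hsum⟩ := ha
  have hhd := hh.differentiableOn
  set g : ℂ → ℂ := fun z => Complex.exp (-(lam : ℂ) * h z) with hg
  have hgd : DifferentiableOn ℂ g (ball 0 1) := (hhd.const_mul _).cexp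
  have hGa : RepSeries (PowerSeries.mk a) g := by
    intro z hz
    simpa [hg] using hsum z hz
  have hGd := hGa.derivative hgd
  simp only [PowerSeries.coeff_mk] at hGd
  set D : PowerSeries ℂ := PowerSeries.mk fun n => ((n : ℂ) + 1) * a (n + 1) with hD
  have hW := repSeries_taylor hω.differentiableOn
  set W : PowerSeries ℂ := PowerSeries.mk fun n => ((n.factorial : ℂ))⁻¹ * iteratedDeriv n ω 0
  set F : PowerSeries ℂ := PowerSeries.C ((lam * (A - B) : ℝ) : ℂ) * PowerSeries.mk a +
    PowerSeries.C (B : ℂ) * (PowerSeries.X * D) with hF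
  have hFrep := (hGa.const_mul ((lam * (A - B) : ℝ) : ℂ)).add
    ((repSeries_X.mul hGd).const_mul (B : ℂ))
  rw [← hF] at hFrep
  -- the differential equation
  have hode : ∀ z ∈ ball (0 : ℂ) 1, z * deriv g z =
      -1 * (z * (ω z * (((lam * (A - B) : ℝ) : ℂ) * g z + (B : ℂ) * (z * deriv g z)))) := by
    intro z hz
    have hhz : HasDerivAt h (deriv h z) z :=
      (hhd.differentiableAt (isOpen_ball.mem_nhds hz)).hasDerivAt
    have hgz : deriv g z = g z * (-(lam : ℂ) * deriv h z) :=
      ((hhz.const_mul (-(lam : ℂ))).cexp).deriv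
    have hfz : deriv f z = Complex.exp (h z) * (1 + z * deriv h z) := by
      have e : f =ᶠ[nhds z] fun z => z * Complex.exp (h z) := by
        filter_upwards [isOpen_ball.mem_nhds hz] with w hw using hfh w hw
      rw [e.deriv_eq]
      have := ((hasDerivAt_id z).mul hhz.cexp).deriv
      simp only [id] at this
      erw [this]
      ring
    rcases eq_or_ne z 0 with rfl | hz0
    · simp
    have h1 := hfe z hz
    rw [hfz, hfh z hz] at h1
    have h2 : (1 + z * deriv h z) * (1 + (B : ℂ) * z * ω z) = 1 + (A : ℂ) * z * ω z := by
      apply mul_left_cancel₀ (mul_ne_zero hz0 (Complex.exp_ne_zero (h z)))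
      linear_combination h1
    rw [hgz]
    push_cast
    linear_combination (-(lam : ℂ) * g z) * h2
  have hid : D = PowerSeries.C (-1 : ℂ) * (W * F) := by
    have h1 := repSeries_X.mul hGd
    have h2 := ((repSeries_X.mul (hW.mul hFrep)).const_mul (-1)).congr
      (fun z hz => (hode z hz).symm)
    have h3 := h1.unique h2
    apply mul_left_cancel₀ (PowerSeries.X_ne_zero (R := ℂ))
    rw [h3]
    ring
  have hFc : ∀ k, PowerSeries.coeff k F = ((lam * (A - B) + B * k : ℝ) : ℂ) * a k := by
    intro k
    rw [hF]
    cases k with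
    | zero => simp
    | succ k => 
      rw [map_add, PowerSeries.coeff_C_mul, PowerSeries.coeff_C_mul,
        PowerSeries.coeff_succ_X_mul, hD, PowerSeries.coeff_mk, PowerSeries.coeff_mk]
      push_cast
      ring
  have hT := repSeries_trunc n F
  set Tn : PowerSeries ℂ := ((PowerSeries.trunc n F : Polynomial ℂ) : PowerSeries ℂ) with hTn
  have hTc : ∀ k, PowerSeries.coeff k Tn = if k < n then PowerSeries.coeff k F else 0 := by
    intro k
    simp [hTn, PowerSeries.coeff_trunc]
  have hmain := sum_sq_le_of_bound (hW.mul hT) hT n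
    (fun k hk => by rw [hTc, if_neg (not_lt.mpr hk)])
    (fun z hz => by
      rw [norm_mul]
      exact mul_le_of_le_one_left (norm_nonneg _) (hω1 z hz))
  refine le_trans (le_of_eq ?_) (hmain.trans (le_of_eq ?_))
  · refine Finset.sum_congr rfl fun k hk => ?_
    rw [Finset.mem_range] at hk
    have e1 : PowerSeries.coeff k (W * Tn) = PowerSeries.coeff k (W * F) := by
      rw [PowerSeries.coeff_mul, PowerSeries.coeff_mul]
      refine Finset.sum_congr rfl fun p hp => ?_
      have := Finset.HasAntidiagonal.mem_antidiagonal.mp hp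
      rw [hTc, if_pos (by omega)]
    have e2 : ((k : ℂ) + 1) * a (k + 1) = - PowerSeries.coeff k (W * F) := by
      have := congrArg (PowerSeries.coeff k) hid
      rw [PowerSeries.coeff_C_mul, hD, PowerSeries.coeff_mk] at this
      rw [this]; ring
    rw [e1, ← norm_neg (PowerSeries.coeff k (W * F)), ← e2, norm_mul, mul_pow]
    congr 2
    have : ((k : ℂ) + 1) = (((k : ℝ) + 1 : ℝ) : ℂ) := by push_cast; rfl
    rw [this, Complex.norm_real, Real.norm_of_nonneg (by positivity)]
  · refine Finset.sum_congr rfl fun k hk => ?_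
    rw [Finset.mem_range] at hk
    rw [hTc, if_pos hk, hFc, norm_mul, mul_pow, Complex.norm_real, Real.norm_eq_abs, sq_abs]

theorem coeff_bound_J_interval (A B lam δ : ℝ) (hB : -1 ≤ B) (hBA : B < A) (hA : A ≤ 1)
    (hlam : 1 < lam) (hδ : δ = (1 - A) / (1 - B))
    (hδ1 : 0 ≤ δ) (hδ2 : δ < (lam - ⌊lam⌋₊) / lam)
    (f : ℂ → ℂ) (hf : IsJanowskiStarlike A B f)
    (a : ℕ → ℂ) (ha : NegPowCoeff lam f a)
    (l : ℕ) (hl1 : 1 ≤ l) (hl2 : l ≤ ⌊lam⌋₊ + 1) :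
    ‖a l‖ ≤ ∏ j ∈ Finset.range l, (lam * (A - B) + B * j) / (j + 1) := by
  have ha0 : a 0 = 1 := by
    obtain ⟨_, _, _, _, h, _⟩ := ha
    exact h
  have hB1 : 0 < 1 - B := by linarith
  have hc : ∀ k : ℕ, k ≤ ⌊lam⌋₊ → (k : ℝ) ≤ lam * (A - B) + B * k := by
    intro k hk
    have hk' : (k : ℝ) ≤ ⌊lam⌋₊ := by exact_mod_cast hk
    rw [hδ, div_lt_div_iff₀ hB1 (by linarith)] at hδ2
    nlinarith
  have htel : ∀ n : ℕ, ∑ k ∈ Finset.range n, ((lam * (A - B) + B * k) ^ 2 - (k : ℝ) ^ 2) *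
      (∏ j ∈ Finset.range k, (lam * (A - B) + B * j) / ((j : ℝ) + 1)) ^ 2 =
      (n : ℝ) ^ 2 * (∏ j ∈ Finset.range n, (lam * (A - B) + B * j) / ((j : ℝ) + 1)) ^ 2 := by
    intro n
    induction n with
    | zero => simp
    | succ n ih =>
      rw [Finset.sum_range_succ, ih, Finset.prod_range_succ]
      have : (n : ℝ) + 1 ≠ 0 := by positivity
      push_cast
      field_simp
      ring
  have hbd : ∀ n : ℕ, (n : ℝ) ^ 2 * ‖a n‖ ^ 2 ≤ ∑ k ∈ Finset.range n,
      ((lam * (A - B) + B * k) ^ 2 - (k : ℝ) ^ 2) * ‖a k‖ ^ 2 := by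
    intro n
    have h1 := clunie_s7 A B lam f hf a ha n
    have h2 := Finset.sum_range_succ' (fun k : ℕ => (k : ℝ) ^ 2 * ‖a k‖ ^ 2) n
    rw [Finset.sum_range_succ] at h2
    simp only [sub_mul, Finset.sum_sub_distrib]
    push_cast at h2
    linarith
  clear hl1
  induction l using Nat.strong_induction_on with
  | _ l ih =>
    rcases Nat.eq_zero_or_pos l with rfl | hl
    · simp [ha0]
    have hP : 0 ≤ ∏ j ∈ Finset.range l, (lam * (A - B) + B * j) / ((j : ℝ) + 1) := by
      refine Finset.prod_nonneg fun j hj => ?_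
      rw [Finset.mem_range] at hj
      have := hc j (by omega)
      have : (0 : ℝ) ≤ j := by positivity
      exact div_nonneg (by linarith) (by linarith)
    have h3 := (hbd l).trans (Finset.sum_le_sum (g := fun k : ℕ =>
        ((lam * (A - B) + B * k) ^ 2 - (k : ℝ) ^ 2) *
        (∏ j ∈ Finset.range k, (lam * (A - B) + B * j) / ((j : ℝ) + 1)) ^ 2) fun k hk => by
      rw [Finset.mem_range] at hk
      have h4 := hc k (by omega)
      have h5 := ih k hk (by omega)
      have h6 : (0 : ℝ) ≤ k := by positivity
      refine mul_le_mul_of_nonneg_left ?_ ?_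
      · gcongr
      · have : (k : ℝ) ^ 2 ≤ (lam * (A - B) + B * k) ^ 2 := by gcongr
        linarith)
    rw [htel] at h3
    have h7 : (0 : ℝ) < (l : ℝ) ^ 2 := by positivity
    exact (sq_le_sq₀ (norm_nonneg _) hP).mp (le_of_mul_le_mul_left h3 h7)
end

section
/- Let f ∈ S* (starlike: zf'(z)/f(z) has positive real part on the unit disk) with f(z) = z + Σ_{n≥2} a_n zⁿ, fix 0 < λ ≤ 1, and write (f(z)/z)^{-λ} = 1 + Σ_{n≥1} a_n(-λ,f) zⁿ. Then |a_l(-λ,f)| ≤ 2λ/l for every l ≥ 1. -/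
open Metric Complex

lemma hs_congr {p q : ℕ → ℂ} {s : ℂ} (h : HasSum q s) (hpq : ∀ n, p n = q n) : HasSum p s := by
  rwa [show p = q from funext hpq]

lemma parseval_fin (u : ℕ → ℂ) (N : ℕ) :
    ∑ k ∈ Finset.range N, ‖u k‖ ^ 2 =
      Real.circleAverage (fun z : ℂ => ‖∑ k ∈ Finset.range N, u k * z ^ k‖ ^ 2) 0 1 := by
  have h := (∑ k ∈ Finset.range N, Polynomial.C (u k) * Polynomial.X ^ k :
    Polynomial ℂ).sum_sq_norm_coeff_eq_circleAverage
  have hc : ∀ i, (∑ k ∈ Finset.range N, Polynomial.C (u k) * Polynomial.X ^ k :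
      Polynomial ℂ).coeff i = if i < N then u i else 0 := by
    intro i
    simp [Polynomial.finsetSum_coeff, Polynomial.coeff_X_pow]
  have he : ∀ z : ℂ, (∑ k ∈ Finset.range N, Polynomial.C (u k) * Polynomial.X ^ k :
      Polynomial ℂ).eval z = ∑ k ∈ Finset.range N, u k * z ^ k := by
    intro z
    simp [Polynomial.eval_finsetSum]
  simp only [he] at h
  rw [← h]
  symm
  have hsub : (∑ k ∈ Finset.range N, Polynomial.C (u k) * Polynomial.X ^ k :
      Polynomial ℂ).support ⊆ Finset.range N := by
    intro i hi
    rw [Polynomial.mem_support_iff, hc] at hi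
    by_contra hn
    simp only [Finset.mem_range] at hn
    simp [hn] at hi
  rw [Finset.sum_subset hsub]
  · refine Finset.sum_congr rfl fun i hi => ?_
    rw [hc, if_pos (Finset.mem_range.1 hi)]
  · intro i _ hi
    rw [Polynomial.notMem_support_iff.1 hi]
    simp

lemma circle_int (u : ℕ → ℂ) (N : ℕ) :
    CircleIntegrable (fun z : ℂ => ‖∑ k ∈ Finset.range N, u k * z ^ k‖ ^ 2) 0 1 := by
  apply ContinuousOn.circleIntegrable zero_le_one
  fun_prop

/-- Uniqueness of power series coefficients. -/
lemma coeff_unique_s11 (p q : ℕ → ℂ) (F : ℂ → ℂ)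
    (hp : ∀ z ∈ ball (0 : ℂ) 1, HasSum (fun n => p n * z ^ n) (F z))
    (hq : ∀ z ∈ ball (0 : ℂ) 1, HasSum (fun n => q n * z ^ n) (F z)) : p = q := by
  have key : ∀ p : ℕ → ℂ, (∀ z ∈ ball (0 : ℂ) 1, HasSum (fun n => p n * z ^ n) (F z)) →
      HasFPowerSeriesAt F (FormalMultilinearSeries.ofScalars ℂ p) 0 := by
    intro p hp
    rw [hasFPowerSeriesAt_iff]
    filter_upwards [ball_mem_nhds (0 : ℂ) one_pos] with z hz
    simpa [FormalMultilinearSeries.coeff_ofScalars, mul_comm] using hp z hz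
  have h := (key p hp).eq_formalMultilinearSeries (key q hq)
  funext n
  rw [← FormalMultilinearSeries.coeff_ofScalars (𝕜 := ℂ) (p := p), h,
    FormalMultilinearSeries.coeff_ofScalars]

/-- Cauchy product of power series. -/
lemma cauchy_mul (p q : ℕ → ℂ) (F G z : ℂ)
    (hp : HasSum (fun n => p n * z ^ n) F) (hq : HasSum (fun n => q n * z ^ n) G) :
    HasSum (fun n => (∑ k ∈ Finset.range (n + 1), p k * q (n - k)) * z ^ n) (F * G) := by
  have h := hasSum_sum_range_mul_of_summable_norm hp.summable.norm hq.summable.norm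
  rw [hp.tsum_eq, hq.tsum_eq] at h
  refine hs_congr h fun n => ?_
  rw [Finset.sum_mul]
  refine Finset.sum_congr rfl fun k hk => ?_
  have : z ^ n = z ^ k * z ^ (n - k) := by
    rw [← pow_add]; congr 1; have := Finset.mem_range.1 hk; omega
  rw [this]; ring

/-- Bessel-type comparison. -/
lemma bessel (e d : ℕ → ℂ) (n m : ℕ) (Q : ℂ → ℂ)
    (hQ : ∀ z ∈ ball (0 : ℂ) 1, HasSum (fun k => e k * z ^ k) (Q z))
    (hb : ∀ z ∈ ball (0 : ℂ) 1, ‖Q z‖ ≤ ‖∑ k ∈ Finset.range n, d k * z ^ k‖)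
    (r : ℝ) (hr0 : 0 < r) (hr1 : r < 1) :
    ∑ k ∈ Finset.range m, ‖e k * (r : ℂ) ^ k‖ ^ 2 ≤
      ∑ k ∈ Finset.range n, ‖d k * (r : ℂ) ^ k‖ ^ 2 := by
  have hrb : (r : ℂ) ∈ ball (0 : ℂ) 1 := by
    simp [abs_of_pos hr0, hr1]
  have hs : Summable (fun k => ‖e k * (r : ℂ) ^ k‖) := (hQ _ hrb).summable.norm
  set τ : ℕ → ℝ := fun M => ∑' k, ‖e (k + M) * (r : ℂ) ^ (k + M)‖ with hτ
  have hτ0 : Filter.Tendsto τ Filter.atTop (nhds 0) :=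
    tendsto_sum_nat_add (fun k => ‖e k * (r : ℂ) ^ k‖)
  have hτn : ∀ M, 0 ≤ τ M := fun M => tsum_nonneg fun _ => norm_nonneg _
  set D := ∑ k ∈ Finset.range n, ‖d k * (r : ℂ) ^ k‖ ^ 2 with hD
  have main : ∀ M, m ≤ M → ∑ k ∈ Finset.range m, ‖e k * (r : ℂ) ^ k‖ ^ 2 ≤
      (1 + τ M) * D + (τ M + τ M ^ 2) := by
    intro M hM
    have h1 : ∑ k ∈ Finset.range m, ‖e k * (r : ℂ) ^ k‖ ^ 2 ≤
        ∑ k ∈ Finset.range M, ‖e k * (r : ℂ) ^ k‖ ^ 2 :=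
      Finset.sum_le_sum_of_subset_of_nonneg (Finset.range_mono hM) fun _ _ _ => by positivity
    refine h1.trans ?_
    rw [hD, parseval_fin (fun k => e k * (r : ℂ) ^ k) M,
      parseval_fin (fun k => d k * (r : ℂ) ^ k) n]
    have h2 : (1 + τ M) * Real.circleAverage
        (fun z : ℂ => ‖∑ k ∈ Finset.range n, d k * (r : ℂ) ^ k * z ^ k‖ ^ 2) 0 1 +
        (τ M + τ M ^ 2) = Real.circleAverage (fun z : ℂ => (1 + τ M) *
          ‖∑ k ∈ Finset.range n, d k * (r : ℂ) ^ k * z ^ k‖ ^ 2 + (τ M + τ M ^ 2)) 0 1 := by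
      have hi := circle_int (fun k => d k * (r : ℂ) ^ k) n
      rw [Real.circleAverage_fun_add, Real.circleAverage_const]
      · congr 1
        exact (Real.circleAverage_fun_smul (𝕜 := ℝ) (a := 1 + τ M) (c := (0 : ℂ)) (R := 1)
          (f := fun z : ℂ => ‖∑ k ∈ Finset.range n, d k * (r : ℂ) ^ k * z ^ k‖ ^ 2)).symm
      · apply ContinuousOn.circleIntegrable zero_le_one
        fun_prop
      · apply ContinuousOn.circleIntegrable zero_le_one
        fun_prop
    rw [h2]
    apply Real.circleAverage_mono
    · exact circle_int _ _
    · apply ContinuousOn.circleIntegrable zero_le_one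
      fun_prop
    · intro z hz
      have hz1 : ‖z‖ = 1 := by simpa using hz
      have hrz : (r : ℂ) * z ∈ ball (0 : ℂ) 1 := by
        simp [hz1, abs_of_pos hr0, hr1]
      have hsum := hQ _ hrz
      have hs2 := (hasSum_nat_add_iff' M).2 hsum
      have htail : ‖Q (r * z) - ∑ k ∈ Finset.range M, e k * ((r : ℂ) * z) ^ k‖ ≤ τ M := by
        rw [← hs2.tsum_eq]
        refine (norm_tsum_le_tsum_norm hs2.summable.norm).trans (le_of_eq ?_)
        refine tsum_congr fun k => ?_
        simp [mul_pow, hz1]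
      have hP := hb _ hrz
      have e1 : ∑ k ∈ Finset.range M, e k * ((r : ℂ) * z) ^ k =
          ∑ k ∈ Finset.range M, e k * (r : ℂ) ^ k * z ^ k :=
        Finset.sum_congr rfl fun k _ => by rw [mul_pow]; ring
      have e2 : ∑ k ∈ Finset.range n, d k * ((r : ℂ) * z) ^ k =
          ∑ k ∈ Finset.range n, d k * (r : ℂ) ^ k * z ^ k :=
        Finset.sum_congr rfl fun k _ => by rw [mul_pow]; ring
      rw [e1] at htail
      rw [e2] at hP
      show ‖∑ k ∈ Finset.range M, e k * (r : ℂ) ^ k * z ^ k‖ ^ 2 ≤ (1 + τ M) *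
          ‖∑ k ∈ Finset.range n, d k * (r : ℂ) ^ k * z ^ k‖ ^ 2 + (τ M + τ M ^ 2)
      have h3 := norm_sub_norm_le (∑ k ∈ Finset.range M, e k * (r : ℂ) ^ k * z ^ k) (Q (r * z))
      rw [norm_sub_rev] at h3
      have h4 := norm_nonneg (∑ k ∈ Finset.range M, e k * (r : ℂ) ^ k * z ^ k)
      generalize ‖∑ k ∈ Finset.range M, e k * (r : ℂ) ^ k * z ^ k‖ = x at *
      generalize ‖∑ k ∈ Finset.range n, d k * (r : ℂ) ^ k * z ^ k‖ = y at *
      have h5 : x ≤ y + τ M := by linarith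
      have h6 := hτn M
      have h7 : x ^ 2 ≤ (y + τ M) ^ 2 := by gcongr
      nlinarith [mul_nonneg h6 (sq_nonneg (y - 1))]
  have hlim : Filter.Tendsto (fun M => (1 + τ M) * D + (τ M + τ M ^ 2)) Filter.atTop
      (nhds ((1 + 0) * D + (0 + 0 ^ 2))) :=
    ((tendsto_const_nhds.add hτ0).mul tendsto_const_nhds).add (hτ0.add (hτ0.pow 2))
  have := ge_of_tendsto hlim (Filter.eventually_atTop.2 ⟨m, main⟩)
  simpa using this

/-- Clunie's inequality. -/
lemma clunie_s11 (c d w : ℕ → ℂ) (F G W : ℂ → ℂ)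
    (hc : ∀ z ∈ ball (0 : ℂ) 1, HasSum (fun k => c k * z ^ k) (F z))
    (hd : ∀ z ∈ ball (0 : ℂ) 1, HasSum (fun k => d k * z ^ k) (G z))
    (hw : ∀ z ∈ ball (0 : ℂ) 1, HasSum (fun k => w k * z ^ k) (W z))
    (hw0 : w 0 = 0) (hW : ∀ z ∈ ball (0 : ℂ) 1, ‖W z‖ ≤ 1)
    (hF : ∀ z ∈ ball (0 : ℂ) 1, F z = G z * W z) (n : ℕ) :
    ∑ k ∈ Finset.range (n + 1), ‖c k‖ ^ 2 ≤ ∑ k ∈ Finset.range n, ‖d k‖ ^ 2 := by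
  have hcc : c = fun n => ∑ k ∈ Finset.range (n + 1), d k * w (n - k) := by
    apply coeff_unique_s11 _ _ F hc
    intro z hz
    rw [hF z hz]
    exact cauchy_mul _ _ _ _ _ (hd z hz) (hw z hz)
  set d' : ℕ → ℂ := fun k => if k < n then d k else 0 with hd'
  have hdts : ∀ z, HasSum (fun k => d' k * z ^ k) (∑ k ∈ Finset.range n, d k * z ^ k) := by
    intro z
    have : ∑ k ∈ Finset.range n, d k * z ^ k = ∑ k ∈ Finset.range n, d' k * z ^ k :=
      Finset.sum_congr rfl fun k hk => by simp [hd', Finset.mem_range.1 hk]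
    rw [this]
    apply hasSum_sum_of_ne_finset_zero
    intro k hk
    have : ¬ k < n := by simpa using hk
    simp [hd', this]
  have hr : ∀ r : ℝ, 0 < r → r < 1 → ∑ k ∈ Finset.range (n + 1), ‖c k * (r : ℂ) ^ k‖ ^ 2 ≤
      ∑ k ∈ Finset.range n, ‖d k * (r : ℂ) ^ k‖ ^ 2 := by
    intro r hr0 hr1
    have hB := bessel (fun n => ∑ k ∈ Finset.range (n + 1), d' k * w (n - k)) d n (n + 1)
      (fun z => (∑ k ∈ Finset.range n, d k * z ^ k) * W z)
      (fun z hz => cauchy_mul _ _ _ _ _ (hdts z) (hw z hz))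
      (fun z hz => by
        rw [norm_mul]
        exact mul_le_of_le_one_right (norm_nonneg _) (hW z hz)) r hr0 hr1
    refine le_trans (le_of_eq ?_) hB
    refine Finset.sum_congr rfl fun k hk => ?_
    have hk' := Finset.mem_range.1 hk
    congr 3
    rw [hcc]
    refine Finset.sum_congr rfl fun i hi => ?_
    have hi' := Finset.mem_range.1 hi
    by_cases hin : i < n
    · simp [hd', hin]
    · have : k - i = 0 := by omega
      rw [this, hw0]; simp
  have t1 : Filter.Tendsto (fun r : ℝ => ∑ k ∈ Finset.range (n + 1), ‖c k * (r : ℂ) ^ k‖ ^ 2)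
      (nhdsWithin 1 (Set.Iio 1)) (nhds (∑ k ∈ Finset.range (n + 1), ‖c k‖ ^ 2)) := by
    have : Continuous (fun r : ℝ => ∑ k ∈ Finset.range (n + 1), ‖c k * (r : ℂ) ^ k‖ ^ 2) := by
      fun_prop
    simpa using (this.tendsto 1).mono_left nhdsWithin_le_nhds
  have t2 : Filter.Tendsto (fun r : ℝ => ∑ k ∈ Finset.range n, ‖d k * (r : ℂ) ^ k‖ ^ 2)
      (nhdsWithin 1 (Set.Iio 1)) (nhds (∑ k ∈ Finset.range n, ‖d k‖ ^ 2)) := by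
    have : Continuous (fun r : ℝ => ∑ k ∈ Finset.range n, ‖d k * (r : ℂ) ^ k‖ ^ 2) := by
      fun_prop
    simpa using (this.tendsto 1).mono_left nhdsWithin_le_nhds
  refine le_of_tendsto_of_tendsto t1 t2 ?_
  filter_upwards [Ioo_mem_nhdsLT (zero_lt_one' ℝ)] with r hr'
  exact hr r hr'.1 hr'.2

lemma taylor (g : ℂ → ℂ) (hg : DifferentiableOn ℂ g (ball 0 1)) :
    ∀ z ∈ ball (0 : ℂ) 1,
      HasSum (fun n => (iteratedDeriv n g 0 / (n.factorial : ℂ)) * z ^ n) (g z) := by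
  intro z hz
  have := Complex.hasSum_taylorSeries_on_ball hg hz
  refine hs_congr this fun n => ?_
  simp; ring

lemma mulz (p : ℕ → ℂ) (F z : ℂ) (hp : HasSum (fun n => p n * z ^ n) F) :
    HasSum (fun n => (if n = 0 then 0 else p (n - 1)) * z ^ n) (z * F) := by
  rw [← hasSum_nat_add_iff' 1]
  simp only [Nat.add_eq_zero_iff, one_ne_zero, and_false, if_false, Nat.add_sub_cancel,
    Finset.range_one, Finset.sum_singleton, if_true, zero_mul, sub_zero]
  refine hs_congr (hp.mul_left z) fun n => ?_
  ring

theorem starlike_coeff_bound_small_lambda (lam : ℝ) (hlam0 : 0 < lam) (hlam1 : lam ≤ 1)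
    (f : ℂ → ℂ) (hf : IsJanowskiStarlike 1 (-1) f)
    (a : ℕ → ℂ) (ha : NegPowCoeff lam f a) (l : ℕ) (hl : 1 ≤ l) :
    ‖a l‖ ≤ 2 * lam / l := by
  obtain ⟨hfa, -, -, ω, hω, hω1, heq⟩ := hf
  obtain ⟨h, hh, h0, hfh, ha0, hsum⟩ := ha
  have hhd : DifferentiableOn ℂ h (ball 0 1) := hh.differentiableOn
  set g : ℂ → ℂ := fun z => Complex.exp (-(lam : ℂ) * h z) with hg
  have hgd : DifferentiableOn ℂ g (ball 0 1) := (hhd.const_mul _).cexp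
  have hacoef : a = fun n => iteratedDeriv n g 0 / (n.factorial : ℂ) :=
    coeff_unique_s11 _ _ g hsum (taylor g hgd)
  have hdgd : DifferentiableOn ℂ (deriv g) (ball 0 1) := hgd.deriv isOpen_ball
  have hF : ∀ z ∈ ball (0 : ℂ) 1, HasSum (fun n : ℕ => ((n : ℂ) * a n) * z ^ n) (z * deriv g z) := by
    intro z hz
    have := mulz _ _ _ (taylor (deriv g) hdgd z hz)
    refine hs_congr this fun n => ?_
    rcases n with _ | n
    · simp
    · rw [hacoef]
      simp only [Nat.succ_ne_zero, if_false, Nat.add_sub_cancel, ← iteratedDeriv_succ']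
      have h1 : ((n : ℂ) + 1) ≠ 0 := by exact_mod_cast Nat.succ_ne_zero n
      have h2 : (n.factorial : ℂ) ≠ 0 := by exact_mod_cast n.factorial_ne_zero
      rw [Nat.factorial_succ]
      push_cast
      field_simp
  have hG : ∀ z ∈ ball (0 : ℂ) 1, HasSum (fun n : ℕ => (((n : ℂ) - 2 * lam) * a n) * z ^ n)
      (z * deriv g z - 2 * lam * g z) := by
    intro z hz
    refine hs_congr ((hF z hz).sub ((hsum z hz).mul_left (2 * (lam : ℂ)))) fun n => ?_
    ring
  have hW : ∀ z ∈ ball (0 : ℂ) 1, ‖z * ω z‖ ≤ 1 := by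
    intro z hz
    rw [norm_mul]
    have : ‖z‖ < 1 := by simpa using hz
    exact mul_le_one₀ this.le (norm_nonneg _) (hω1 z hz)
  have hrel : ∀ z ∈ ball (0 : ℂ) 1,
      z * deriv g z = (z * deriv g z - 2 * lam * g z) * (z * ω z) := by
    intro z hz
    rcases eq_or_ne z 0 with rfl | hz0
    · simp
    have hd := (hhd.differentiableAt (isOpen_ball.mem_nhds hz)).hasDerivAt
    have hgz : deriv g z = Complex.exp (-(lam : ℂ) * h z) * (-(lam : ℂ) * deriv h z) :=
      (hd.const_mul _).cexp.deriv
    have hfz : deriv f z = Complex.exp (h z) + z * (Complex.exp (h z) * deriv h z) := by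
      have h1 : HasDerivAt (fun y => y * Complex.exp (h y))
          (1 * Complex.exp (h z) + z * (Complex.exp (h z) * deriv h z)) z :=
        (hasDerivAt_id z).mul hd.cexp
      have h2 : f =ᶠ[nhds z] fun y => y * Complex.exp (h y) := by
        filter_upwards [isOpen_ball.mem_nhds hz] with y hy using hfh y hy
      rw [h2.deriv_eq, h1.deriv, one_mul]
    have h3 := heq z hz
    rw [hfz, hfh z hz] at h3
    have hne : z * Complex.exp (h z) ≠ 0 := mul_ne_zero hz0 (Complex.exp_ne_zero _)
    have h4 : (1 + z * deriv h z) * (1 - z * ω z) = 1 + z * ω z := by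
      apply mul_left_cancel₀ hne
      push_cast at h3
      linear_combination h3
    rw [hgz, hg]
    simp only
    linear_combination (-(lam : ℂ) * Complex.exp (-(lam : ℂ) * h z)) * h4
  have hcl := clunie_s11 _ _ _ _ _ _ hF hG
    (fun z hz => mulz _ _ _ (taylor ω hω.differentiableOn z hz)) (by simp) hW hrel l
  rw [Finset.sum_range_succ] at hcl
  obtain ⟨m, rfl⟩ : ∃ m, l = m + 1 := ⟨l - 1, by omega⟩
  rw [Finset.sum_range_succ', Finset.sum_range_succ' (fun k => ‖((k : ℂ) - 2 * lam) * a k‖ ^ 2)]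
    at hcl
  have hle : ∑ k ∈ Finset.range m, ‖(((k + 1 : ℕ) : ℂ) - 2 * lam) * a (k + 1)‖ ^ 2 ≤
      ∑ k ∈ Finset.range m, ‖((k + 1 : ℕ) : ℂ) * a (k + 1)‖ ^ 2 := by
    refine Finset.sum_le_sum fun k _ => ?_
    rw [norm_mul, norm_mul]
    gcongr
    have e1 : (((k + 1 : ℕ) : ℂ) - 2 * lam) = (((k + 1 : ℕ) : ℝ) - 2 * lam : ℝ) := by
      push_cast; ring
    rw [e1, Complex.norm_real, Complex.norm_natCast, Real.norm_eq_abs, abs_le]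
    have : (0 : ℝ) ≤ k := k.cast_nonneg
    push_cast
    constructor <;> linarith
  have e0 : ‖(((0 : ℕ) : ℂ) - 2 * lam) * a 0‖ = 2 * lam := by
    rw [ha0]; simp [abs_of_pos hlam0]
  have e2 : ‖(((0 : ℕ) : ℂ)) * a 0‖ ^ 2 = 0 := by simp
  rw [e0, e2] at hcl
  have hfin : ‖((m + 1 : ℕ) : ℂ) * a (m + 1)‖ ^ 2 ≤ (2 * lam) ^ 2 := by linarith
  have hfin2 := abs_le_of_sq_le_sq hfin (by positivity)
  rw [abs_of_nonneg (norm_nonneg _), norm_mul, Complex.norm_natCast] at hfin2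
  rw [le_div_iff₀ (by positivity)]
  linarith
end

section
/- Let g ∈ Σ*(A,B) with expansion g(z) = z(1 + Σ_{n≥1} b_n z^{-n}) for |z|>1, where -1 ≤ B < A ≤ 1. Then |b_n| ≤ (A-B)/n for all n ≥ 1. -/
open Metric Complex

/-- The class `Σ*(A,B)` of meromorphic univalent functions
`g(z) = z (1 + Σ_{n≥1} b_n z^{-n})` on `|z| > 1` with
`(1/z) g'(1/z) / g(1/z)` subordinate to `(1+Az)/(1+Bz)`. -/
def IsJanowskiMeroStarlike (A B : ℝ) (g : ℂ → ℂ) (b : ℕ → ℂ) : Prop :=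
  DifferentiableOn ℂ g {z : ℂ | 1 < ‖z‖} ∧
    Set.InjOn g {z : ℂ | 1 < ‖z‖} ∧
    b 0 = 0 ∧
    (∀ z : ℂ, 1 < ‖z‖ → HasSum (fun n : ℕ => b n * z ^ (-(n : ℤ))) (g z / z - 1)) ∧
    ∃ ω : ℂ → ℂ, AnalyticOn ℂ ω (ball 0 1) ∧ (∀ z ∈ ball (0 : ℂ) 1, ‖ω z‖ ≤ 1) ∧
      ∀ z ∈ ball (0 : ℂ) 1, z ≠ 0 →
        deriv g (1 / z) * (1 + (B : ℂ) * z * ω z)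
          = z * g (1 / z) * (1 + (A : ℂ) * z * ω z)

open Real in
lemma orth_aux (N : ℕ) (a : ℕ → ℂ) (R : ℂ → ℂ) (hR : DifferentiableOn ℂ R (ball 0 1))
    (r : ℝ) (hr0 : 0 < r) (hr1 : r < 1) :
    circleAverage (fun z => ‖(∑ k ∈ Finset.range N, a k * z ^ k) + z ^ N * R z‖ ^ 2) 0 r
      = circleAverage (fun z => ‖∑ k ∈ Finset.range N, a k * z ^ k‖ ^ 2) 0 r
        + circleAverage (fun z => ‖z ^ N * R z‖ ^ 2) 0 r := by
  have hsub : closedBall (0 : ℂ) r ⊆ ball 0 1 := closedBall_subset_ball hr1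
  have hsph : sphere (0 : ℂ) r ⊆ ball 0 1 := sphere_subset_closedBall.trans hsub
  have hRc : ContinuousOn R (sphere 0 r) := (hR.continuousOn).mono hsph
  set G : ℂ → ℂ := fun z => ∑ k ∈ Finset.range N,
    (starRingEnd ℂ) (a k) * (r : ℂ) ^ (2 * k) * (z ^ (N - k) * R z) with hG
  have hGd : DifferentiableOn ℂ G (ball 0 1) := by
    rw [hG]
    refine DifferentiableOn.fun_sum fun k _ => ?_
    exact ((differentiableOn_id.pow _).mul hR).const_mul _
  have hGc : ContinuousOn G (sphere 0 r) := hGd.continuousOn.mono hsph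
  have hGi : CircleIntegrable G 0 r := hGc.circleIntegrable hr0.le
  have hG0 : circleAverage G 0 r = 0 := by
    have h1 : circleAverage G 0 r = G 0 := by
      apply circleAverage_of_differentiable_on_off_countable Set.countable_empty
      · rw [abs_of_pos hr0]; exact hGd.continuousOn.mono hsub
      · intro z hz
        rw [abs_of_pos hr0] at hz
        exact hGd.differentiableAt (isOpen_ball.mem_nhds (hsub (ball_subset_closedBall hz.1)))
    rw [h1, hG]
    refine Finset.sum_eq_zero fun k hk => ?_
    have : N - k ≠ 0 := by have := Finset.mem_range.1 hk; omega
    simp [this]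
  have hre : circleAverage (fun z => 2 * (G z).re) 0 r = 0 := by
    have := ContinuousLinearMap.circleAverage_comp_comm ((2 : ℝ) • Complex.reCLM) hGi
    rw [hG0, map_zero] at this
    rw [← this]
    rfl
  have hP : ContinuousOn (fun z : ℂ => ‖∑ k ∈ Finset.range N, a k * z ^ k‖ ^ 2) (sphere 0 r) := by
    fun_prop
  have hQ : ContinuousOn (fun z : ℂ => ‖z ^ N * R z‖ ^ 2) (sphere 0 r) := by
    fun_prop
  have hRe : ContinuousOn (fun z : ℂ => 2 * (G z).re) (sphere 0 r) := by
    exact continuousOn_const.mul (Complex.continuous_re.comp_continuousOn hGc)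
  have key : circleAverage (fun z => ‖(∑ k ∈ Finset.range N, a k * z ^ k) + z ^ N * R z‖ ^ 2) 0 r
      = circleAverage (fun z => (‖∑ k ∈ Finset.range N, a k * z ^ k‖ ^ 2 + ‖z ^ N * R z‖ ^ 2)
        + 2 * (G z).re) 0 r := by
    apply circleAverage_congr_sphere
    intro z hz
    rw [abs_of_pos hr0, mem_sphere_zero_iff_norm] at hz
    have hGz : G z = (starRingEnd ℂ) (∑ k ∈ Finset.range N, a k * z ^ k) * (z ^ N * R z) := by
      rw [hG, map_sum, Finset.sum_mul]
      refine Finset.sum_congr rfl fun k hk => ?_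
      have hk' := Finset.mem_range.1 hk
      have e1 : (r : ℂ) ^ 2 = (starRingEnd ℂ) z * z := by
        rw [← hz, mul_comm, Complex.mul_conj, Complex.normSq_eq_norm_sq]; push_cast; rfl
      have e2 : z ^ N = z ^ k * z ^ (N - k) := by rw [← pow_add]; congr 1; omega
      rw [map_mul, map_pow, pow_mul, e1, e2, mul_pow]
      ring
    simp only []
    rw [hGz, ← Complex.normSq_eq_norm_sq, ← Complex.normSq_eq_norm_sq, ← Complex.normSq_eq_norm_sq,
      Complex.normSq_add]
    congr 2
    simp only [Complex.mul_re, Complex.conj_re, Complex.conj_im]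
    ring
  rw [key, circleAverage_fun_add, circleAverage_fun_add, hre, add_zero]
  · exact hP.circleIntegrable hr0.le
  · exact hQ.circleIntegrable hr0.le
  · exact (hP.add hQ).circleIntegrable hr0.le
  · exact hRe.circleIntegrable hr0.le

open Real in
lemma parseval_aux (N : ℕ) (a : ℕ → ℂ) (r : ℝ) (hr0 : 0 < r) (hr1 : r < 1) :
    circleAverage (fun z => ‖∑ k ∈ Finset.range N, a k * z ^ k‖ ^ 2) 0 r
      = ∑ k ∈ Finset.range N, ‖a k‖ ^ 2 * r ^ (2 * k) := by
  induction N with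
  | zero => simp [circleAverage_const]
  | succ N ih =>
    have h := orth_aux N a (fun _ => a N) (differentiableOn_const _) r hr0 hr1
    rw [ih] at h
    simp only [Finset.sum_range_succ]
    simp only [mul_comm (a N)]
    rw [h]
    congr 1
    apply circleAverage_const_on_circle
    intro z hz
    rw [abs_of_pos hr0, mem_sphere_zero_iff_norm] at hz
    rw [norm_mul, norm_pow, hz]; ring

/-- The Clunie / Rogosinski inequality. -/
lemma clunie_aux (N M : ℕ) (p q : ℕ → ℂ) (w R : ℂ → ℂ) (hR : DifferentiableOn ℂ R (ball 0 1))
    (hw : ∀ z ∈ ball (0 : ℂ) 1, ‖w z‖ ≤ 1)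
    (h : ∀ z ∈ ball (0 : ℂ) 1, z ≠ 0 → (∑ k ∈ Finset.range N, p k * z ^ k) + z ^ N * R z
      = w z * ∑ k ∈ Finset.range M, q k * z ^ k) :
    ∑ k ∈ Finset.range N, ‖p k‖ ^ 2 ≤ ∑ k ∈ Finset.range M, ‖q k‖ ^ 2 := by
  have main : ∀ r : ℝ, 0 < r → r < 1 → ∑ k ∈ Finset.range N, ‖p k‖ ^ 2 * r ^ (2 * k)
      ≤ ∑ k ∈ Finset.range M, ‖q k‖ ^ 2 * r ^ (2 * k) := by
    intro r hr0 hr1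
    have hsph : sphere (0 : ℂ) r ⊆ ball 0 1 :=
      sphere_subset_closedBall.trans (closedBall_subset_ball hr1)
    have hRc : ContinuousOn R (sphere 0 r) := (hR.continuousOn).mono hsph
    rw [← parseval_aux N p r hr0 hr1, ← parseval_aux M q r hr0 hr1]
    have h1 := orth_aux N p R hR r hr0 hr1
    have h2 : 0 ≤ Real.circleAverage (fun z => ‖z ^ N * R z‖ ^ 2) 0 r :=
      Real.circleAverage_nonneg_of_nonneg (fun z _ => by positivity)
    refine le_trans (by linarith) (h1.symm.le.trans ?_ : _ ≤ _)
    apply Real.circleAverage_mono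
    · apply ContinuousOn.circleIntegrable hr0.le; fun_prop
    · apply ContinuousOn.circleIntegrable hr0.le; fun_prop
    · intro z hz
      rw [abs_of_pos hr0] at hz
      have hz1 := hsph hz
      have hz0 : z ≠ 0 := by
        rintro rfl
        simp at hz; linarith
      rw [h z hz1 hz0, norm_mul]
      have := hw z hz1
      gcongr
      exact mul_le_of_le_one_left (norm_nonneg _) this
  have t : ∀ (K : ℕ) (a : ℕ → ℂ), Filter.Tendsto
      (fun r : ℝ => ∑ k ∈ Finset.range K, ‖a k‖ ^ 2 * r ^ (2 * k)) (nhdsWithin 1 (Set.Iio 1))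
      (nhds (∑ k ∈ Finset.range K, ‖a k‖ ^ 2)) := by
    intro K a
    have : Continuous (fun r : ℝ => ∑ k ∈ Finset.range K, ‖a k‖ ^ 2 * r ^ (2 * k)) := by fun_prop
    have h := (this.tendsto 1).mono_left (nhdsWithin_le_nhds (s := Set.Iio 1))
    simpa using h
  refine le_of_tendsto_of_tendsto (t N p) (t M q) ?_
  filter_upwards [Ioo_mem_nhdsLT (show (0 : ℝ) < 1 by norm_num)] with r hr
  exact main r hr.1 hr.2

/-- Tail of a power series. -/
noncomputable def tailSeries (c : ℕ → ℂ) (N : ℕ) (z : ℂ) : ℂ := ∑' k, c (k + N) * z ^ k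

lemma tail_diff (c : ℕ → ℂ) (hc : ∀ z ∈ ball (0 : ℂ) 1, Summable fun k => c k * z ^ k) (N : ℕ) :
    DifferentiableOn ℂ (tailSeries c N) (ball 0 1) := by
  intro z hz
  obtain ⟨s, hs1, hs2⟩ := exists_between (mem_ball_zero_iff.1 hz)
  have hs0 : 0 < s := (norm_nonneg z).trans_lt hs1
  have hsum : Summable fun k => ‖c (k + N)‖ * s ^ k := by
    have h1 := (hc (s : ℂ) (by simp [abs_of_pos hs0, hs2])).norm
    have h2 := ((summable_nat_add_iff N).2 h1).mul_right ((s ^ N)⁻¹)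
    refine h2.congr fun k => ?_
    rw [norm_mul, norm_pow, Complex.norm_real, Real.norm_of_nonneg hs0.le, pow_add]
    field_simp
  have : DifferentiableOn ℂ (tailSeries c N) (ball 0 s) := by
    apply differentiableOn_tsum_of_summable_norm hsum _ isOpen_ball
    · intro k w hw
      rw [norm_mul, norm_pow]
      have := (mem_ball_zero_iff.1 hw).le
      gcongr
    · intro k; fun_prop
  exact (this.differentiableAt (isOpen_ball.mem_nhds (mem_ball_zero_iff.2 hs1))).differentiableWithinAt

lemma tail_split (c : ℕ → ℂ) (hc : ∀ z ∈ ball (0 : ℂ) 1, Summable fun k => c k * z ^ k) (N : ℕ)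
    (z : ℂ) (hz : z ∈ ball (0 : ℂ) 1) :
    tailSeries c 0 z = (∑ k ∈ Finset.range N, c k * z ^ k) + z ^ N * tailSeries c N z := by
  unfold tailSeries
  rw [← tsum_mul_left]
  have := (hc z hz).sum_add_tsum_nat_add N
  simp only [add_zero]
  rw [← this]
  congr 1
  refine tsum_congr fun k => ?_
  ring

lemma tail_deriv (c : ℕ → ℂ) (hc : ∀ z ∈ ball (0 : ℂ) 1, Summable fun k => c k * z ^ k) (N : ℕ)
    (z : ℂ) (hz : z ∈ ball (0 : ℂ) 1) :
    z * deriv (tailSeries c 0) z = (∑ k ∈ Finset.range N, (k * c k) * z ^ k)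
      + z ^ N * (N * tailSeries c N z + z * deriv (tailSeries c N) z) := by
  have hn := isOpen_ball.mem_nhds hz
  have hd := ((tail_diff c hc N).differentiableAt hn).hasDerivAt
  have h1 : HasDerivAt (fun z => (∑ k ∈ Finset.range N, c k * z ^ k) + z ^ N * tailSeries c N z)
      ((∑ k ∈ Finset.range N, c k * (k * z ^ (k - 1))) +
        ((N * z ^ (N - 1)) * tailSeries c N z + z ^ N * deriv (tailSeries c N) z)) z :=
    (HasDerivAt.fun_sum fun k _ => (hasDerivAt_pow k z).const_mul (c k)).add
      ((hasDerivAt_pow N z).mul hd)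
  have h2 : tailSeries c 0 =ᶠ[nhds z]
      (fun z => (∑ k ∈ Finset.range N, c k * z ^ k) + z ^ N * tailSeries c N z) := by
    filter_upwards [hn] with w hw using tail_split c hc N w hw
  have e : ∀ k : ℕ, z * ((k : ℂ) * z ^ (k - 1)) = k * z ^ k := by
    intro k
    cases k with
    | zero => simp
    | succ k => simp [pow_succ]; ring
  rw [h2.deriv_eq, h1.deriv, mul_add, Finset.mul_sum]
  congr 1
  · refine Finset.sum_congr rfl fun k _ => ?_
    linear_combination c k * e k
  · linear_combination tailSeries c N z * e N

theorem mero_coeff_bound (A B : ℝ) (hB : -1 ≤ B) (hBA : B < A) (hA : A ≤ 1)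
    (g : ℂ → ℂ) (b : ℕ → ℂ) (hg : IsJanowskiMeroStarlike A B g b)
    (n : ℕ) (hn : 1 ≤ n) :
    ‖b n‖ ≤ (A - B) / n := by
  obtain ⟨-, -, hb0, hsum, ω, hω, hω1, heq⟩ := hg
  set c : ℕ → ℂ := fun k => b k + if k = 0 then 1 else 0 with hcdef
  have hcs : ∀ z : ℂ, 1 < ‖z‖ → HasSum (fun k => c k * (z⁻¹) ^ k) (g z / z) := by
    intro z hz
    have h1 := (hsum z hz).add (hasSum_ite_eq (0 : ℕ) (1 : ℂ))
    rw [sub_add_cancel] at h1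
    refine h1.congr_fun ?_ |> fun h => h
    intro k
    rcases Nat.eq_zero_or_pos k with rfl | hk
    · simp [hcdef]
    · simp [hcdef, hk.ne']
  have hc : ∀ z ∈ ball (0 : ℂ) 1, Summable fun k => c k * z ^ k := by
    intro z hz
    by_cases h0 : z = 0
    · subst h0
      apply summable_of_ne_finset_zero (s := {0})
      intro k hk
      simp at hk
      simp [hk]
    · have hz' : 1 < ‖z⁻¹‖ := by
        rw [norm_inv]
        exact (one_lt_inv₀ (norm_pos_iff.2 h0)).2 (mem_ball_zero_iff.1 hz)
      simpa using (hcs z⁻¹ hz').summable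
  set H := tailSeries c 0 with hH
  have hgH : ∀ z : ℂ, 1 < ‖z‖ → g z = z * H z⁻¹ := by
    intro z hz
    have hz0 : z ≠ 0 := by rintro rfl; simp at hz; linarith
    have : H z⁻¹ = g z / z := by
      rw [hH]; unfold tailSeries; simpa using (hcs z hz).tsum_eq
    rw [this]; field_simp
  have hfun : ∀ z ∈ ball (0 : ℂ) 1, z ≠ 0 →
      -(z * deriv H z) = z * ω z * ((A - B) * H z + B * (z * deriv H z)) := by
    intro z hz h0
    have hz' : 1 < ‖z⁻¹‖ := by
      rw [norm_inv]
      exact (one_lt_inv₀ (norm_pos_iff.2 h0)).2 (mem_ball_zero_iff.1 hz)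
    have hd : HasDerivAt H (deriv H z) z :=
      ((tail_diff c hc 0).differentiableAt (isOpen_ball.mem_nhds hz)).hasDerivAt
    have hdg : deriv g z⁻¹ = H z - z * deriv H z := by
      have hev : g =ᶠ[nhds z⁻¹] fun w => w * H w⁻¹ := by
        filter_upwards [(isOpen_lt continuous_const continuous_norm).mem_nhds hz'] with w hw
        exact hgH w hw
      have hi := hasDerivAt_inv (inv_ne_zero h0)
      have hd' : HasDerivAt H (deriv H z) (z⁻¹)⁻¹ := by rwa [inv_inv]
      have h3 := (hasDerivAt_id z⁻¹).mul (HasDerivAt.comp z⁻¹ hd' hi)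
      have h4 : HasDerivAt (fun w => w * H w⁻¹) _ z⁻¹ := h3
      rw [hev.deriv_eq, h4.deriv]
      simp
      field_simp
      ring
    have hE := heq z hz h0
    rw [one_div, hdg, hgH _ hz', inv_inv] at hE
    have : z * (z⁻¹ * H z) = H z := by field_simp
    rw [this] at hE
    linear_combination hE
  have hωd : DifferentiableOn ℂ ω (ball 0 1) := hω.differentiableOn
  have hdT : ∀ N : ℕ, DifferentiableOn ℂ
      (fun z => (N : ℂ) * tailSeries c N z + z * deriv (tailSeries c N) z) (ball 0 1) := by
    intro N
    have h1 := tail_diff c hc N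
    exact (h1.const_mul _).add (differentiableOn_id.mul (h1.deriv isOpen_ball))
  have hcl := clunie_aux (n + 1) n (fun k => -(k * c k)) (fun k => ((A - B) + B * k) * c k)
    (fun z => z * ω z)
    (fun z => -((n + 1 : ℕ) * tailSeries c (n + 1) z + z * deriv (tailSeries c (n + 1)) z)
      - ω z * ((A - B) * tailSeries c n z
        + B * (n * tailSeries c n z + z * deriv (tailSeries c n) z)))
    ((hdT (n + 1)).neg.sub (hωd.mul (((tail_diff c hc n).const_mul _).add ((hdT n).const_mul _))))
    (fun z hz => by
      rw [norm_mul]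
      exact mul_le_one₀ (mem_ball_zero_iff.1 hz).le (norm_nonneg _) (hω1 z hz))
    (fun z hz h0 => by
      have e1 := hfun z hz h0
      have e2 := tail_deriv c hc (n + 1) z hz
      have e3 := tail_deriv c hc n z hz
      have e4 := tail_split c hc n z hz
      have s1 : ∑ k ∈ Finset.range (n + 1), -(k * c k) * z ^ k
          = -∑ k ∈ Finset.range (n + 1), (k * c k) * z ^ k := by
        rw [← Finset.sum_neg_distrib]
        exact Finset.sum_congr rfl fun k _ => by ring
      have s2 : ∑ k ∈ Finset.range n, (((A : ℂ) - B) + B * k) * c k * z ^ k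
          = (A - B) * ∑ k ∈ Finset.range n, c k * z ^ k
            + B * ∑ k ∈ Finset.range n, (k * c k) * z ^ k := by
        rw [Finset.mul_sum, Finset.mul_sum, ← Finset.sum_add_distrib]
        exact Finset.sum_congr rfl fun k _ => by ring
      rw [s1, s2]
      rw [← hH] at e2 e3 e4
      linear_combination e1 + e2 + z * ω z * (A - B) * e4 + z * ω z * B * e3)
  have hck : ∀ k, 1 ≤ k → c k = b k := by
    intro k hk
    simp [hcdef, show k ≠ 0 by omega]
  have hc0 : c 0 = 1 := by simp [hcdef, hb0]
  obtain ⟨m, rfl⟩ : ∃ m, n = m + 1 := ⟨n - 1, by omega⟩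
  rw [Finset.sum_range_succ, Finset.sum_range_succ', Finset.sum_range_succ'] at hcl
  have hle : ∑ k ∈ Finset.range m, ‖((A : ℂ) - B + B * ((k + 1 : ℕ) : ℂ)) * c (k + 1)‖ ^ 2
      ≤ ∑ k ∈ Finset.range m, ‖-(((k + 1 : ℕ) : ℂ) * c (k + 1))‖ ^ 2 := by
    refine Finset.sum_le_sum fun k _ => ?_
    rw [norm_neg, norm_mul, norm_mul]
    have : ‖(A : ℂ) - B + B * ((k + 1 : ℕ) : ℂ)‖ ≤ ‖((k + 1 : ℕ) : ℂ)‖ := by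
      have e : (A : ℂ) - B + B * ((k + 1 : ℕ) : ℂ) = ((A + B * k : ℝ) : ℂ) := by
        push_cast; ring
      rw [e, Complex.norm_real, Complex.norm_natCast, Real.norm_eq_abs, abs_le]
      have hk : (0 : ℝ) ≤ k := Nat.cast_nonneg k
      push_cast
      constructor <;> nlinarith
    gcongr
  have hfin : ‖-(((m + 1 : ℕ) : ℂ) * c (m + 1))‖ ^ 2 ≤ (A - B) ^ 2 := by
    have z1 : ‖-(((0 : ℕ) : ℂ) * c 0)‖ ^ 2 = 0 := by simp
    have z2 : ‖((A : ℂ) - B + B * ((0 : ℕ) : ℂ)) * c 0‖ ^ 2 = (A - B) ^ 2 := by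
      rw [hc0]
      have e : ((A : ℂ) - B + B * ((0 : ℕ) : ℂ)) * 1 = ((A - B : ℝ) : ℂ) := by push_cast; ring
      rw [e, Complex.norm_real, Real.norm_eq_abs, sq_abs]
    linarith
  rw [norm_neg, norm_mul, Complex.norm_natCast, hck _ hn] at hfin
  have := le_of_sq_le_sq hfin (by linarith)
  rw [le_div_iff₀ (by positivity), mul_comm]
  exact this
end

section
/- Let -1 ≤ B < A ≤ 1, f ∈ S*(A,B), δ = (1-A)/(1-B), and F(w) = w + Σ_{n≥2} A_n wⁿ the inverse of f near the origin. Fix n ≥ 2 and suppose 0 ≤ δ < 2/n. Then |A_n| ≤ (1/n)·Π_{j=0}^{n-2} (n(A-B)+Bj)/(j+1). -/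
open Metric Complex

open PowerSeries in
lemma lagrange_formal (u R : PowerSeries ℂ) (hu : PowerSeries.constantCoeff u = 1) (a : ℕ → ℂ) (n : ℕ) (hn : 1 ≤ n)
    (h : (X : PowerSeries ℂ) = ∑ k ∈ Finset.range (n+1), C (a k) * (X * u) ^ k + (X * u) ^ (n+1) * R) :
    (n : ℂ) * a n = coeff (n-1) (u⁻¹ ^ n) := by
  set v := u⁻¹ with hv
  have huv : u * v = 1 := PowerSeries.mul_inv_cancel u (by rw [hu]; exact one_ne_zero)
  have hdv : d⁄dX ℂ v = - v ^ 2 * d⁄dX ℂ u := by rw [hv, derivative_inv']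
  have hpv : X * u * v = X := by rw [mul_assoc, huv, mul_one]
  have hdphi : d⁄dX ℂ (X * u) = u + X * d⁄dX ℂ u := by
    rw [Derivation.leibniz, derivative_X]; simp only [smul_eq_mul]; ring
  have key : ∀ k, 1 ≤ k → k ≤ n →
      coeff (n-1) ((X*u)^(k-1) * d⁄dX ℂ (X*u) * v^n) = if k = n then 1 else 0 := by
    intro k hk hkn
    obtain ⟨m, rfl⟩ := Nat.exists_eq_add_of_le hkn
    obtain ⟨l, rfl⟩ := Nat.exists_eq_add_of_le hk
    have e1 : (X*u)^(1+l-1) * d⁄dX ℂ (X*u) * v^(1+l+m) = X^l * (v^m + X * (d⁄dX ℂ u * v^(m+1))) := by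
      rw [hdphi]
      have : (1 + l - 1) = l := by omega
      rw [this]
      calc (X * u) ^ l * (u + X * (d⁄dX ℂ) u) * v ^ (1 + l + m) 
          = (X * u * v)^l * (u * v * v^m + X * ((d⁄dX ℂ) u * v^(m+1))) := by ring
        _ = _ := by rw [hpv, huv, one_mul]
    rw [e1]
    have : 1 + l + m - 1 = m + l := by omega
    rw [this, coeff_X_pow_mul]
    rcases m with _ | m
    · simp
    · rw [if_neg (by omega)]
      have hd : d⁄dX ℂ (v^(m+1)) = ((m+1 : ℕ) : PowerSeries ℂ) * (- (d⁄dX ℂ u * v^(m+1+1))) := by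
        rw [derivative_pow, hdv]; simp; ring
      have h2 := congrArg (coeff m) hd
      rw [coeff_derivative, ← map_natCast (C (R := ℂ)), coeff_C_mul, map_neg] at h2
      rw [map_add, coeff_succ_X_mul]
      have hm : ((m+1 : ℕ) : ℂ) ≠ 0 := by exact_mod_cast Nat.succ_ne_zero m
      apply mul_left_cancel₀ hm
      push_cast at h2 ⊢
      linear_combination h2
  have hD := congrArg (fun y => coeff (n-1) (d⁄dX ℂ y * v^n)) h
  simp only [derivative_X, one_mul, map_add, map_sum, add_mul, Finset.sum_mul] at hD
  rw [hD]
  have hrest : coeff (n-1) (d⁄dX ℂ ((X*u)^(n+1) * R) * v^n) = 0 := by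
    have : d⁄dX ℂ ((X*u)^(n+1) * R) * v^n = X^n * (X*u*d⁄dX ℂ R + ((n+1 : ℕ) : PowerSeries ℂ)*d⁄dX ℂ (X*u)*R) := by
      rw [Derivation.leibniz, derivative_pow]
      simp only [smul_eq_mul, Nat.add_sub_cancel]
      calc _ = (X*u*v)^n * (X*u*d⁄dX ℂ R + ((n+1 : ℕ) : PowerSeries ℂ)*d⁄dX ℂ (X*u)*R) := by ring
        _ = _ := by rw [hpv]
    rw [this, coeff_X_pow_mul', if_neg (by omega)]
  rw [hrest, add_zero, Finset.sum_eq_single n]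
  · have := key n hn le_rfl
    rw [if_pos rfl] at this
    rw [Derivation.leibniz, derivative_pow, derivative_C]
    simp only [smul_eq_mul, mul_zero, add_zero]
    rw [show C (a n) * (↑n * (X * u) ^ (n - 1) * (d⁄dX ℂ) (X * u)) * v ^ n = C (a n * n) * ((X * u) ^ (n - 1) * (d⁄dX ℂ) (X * u) * v ^ n) by
      rw [map_mul (C (R := ℂ)), map_natCast (C (R := ℂ))]; ring, coeff_C_mul, this]
    ring
  · intro k hk hkn
    rw [Finset.mem_range] at hk
    rw [Derivation.leibniz, derivative_pow, derivative_C]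
    simp only [smul_eq_mul, mul_zero, add_zero]
    rcases Nat.eq_zero_or_pos k with rfl | hk0
    · simp
    have := key k hk0 (by omega)
    rw [if_neg hkn] at this
    rw [show C (a k) * (↑k * (X * u) ^ (k - 1) * (d⁄dX ℂ) (X * u)) * v ^ n = C (a k * k) * ((X * u) ^ (k - 1) * (d⁄dX ℂ) (X * u) * v ^ n) by
      rw [map_mul (C (R := ℂ)), map_natCast (C (R := ℂ))]; ring, coeff_C_mul, this, mul_zero]
  · intro h; exact absurd (Finset.mem_range.2 (Nat.lt_succ_self n)) h

open PowerSeries in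
lemma ode_formal (u W : PowerSeries ℂ) (hu : PowerSeries.constantCoeff u = 1) (A B : ℂ) (n : ℕ)
    (h : X * d⁄dX ℂ (X * u) * (1 + C B * X * W) = X * u * (1 + C A * X * W)) :
    d⁄dX ℂ (u⁻¹ ^ n) = W * (-(C (n * (A - B)) * u⁻¹ ^ n + C B * (X * d⁄dX ℂ (u⁻¹ ^ n)))) := by
  set v := u⁻¹ with hv
  have huv : u * v = 1 := PowerSeries.mul_inv_cancel u (by rw [hu]; exact one_ne_zero)
  have hdv : d⁄dX ℂ v = - v ^ 2 * d⁄dX ℂ u := by rw [hv, derivative_inv']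
  have hdphi : d⁄dX ℂ (X * u) = u + X * d⁄dX ℂ u := by
    rw [Derivation.leibniz, derivative_X]; simp only [smul_eq_mul]; ring
  have h1 : d⁄dX ℂ u * (1 + C B * X * W) = (C A - C B) * W * u := by
    have hX : (X * X : PowerSeries ℂ) ≠ 0 := mul_ne_zero X_ne_zero X_ne_zero
    apply mul_left_cancel₀ hX
    rw [hdphi] at h
    linear_combination h
  have hd : d⁄dX ℂ (v ^ n) = - n * (v ^ n * v * d⁄dX ℂ u) := by
    rw [derivative_pow, hdv]
    rcases n with _ | n
    · simp
    · simp only [Nat.add_sub_cancel]; ring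
  rw [hd, map_mul, map_sub, map_natCast]
  linear_combination (-(n:PowerSeries ℂ) * v^n * v) * h1 + (-(n:PowerSeries ℂ) * v^n) * (C A - C B) * W * huv

noncomputable def taySer (g : ℂ → ℂ) : PowerSeries ℂ :=
  PowerSeries.mk fun k => ((k.factorial : ℕ) : ℂ)⁻¹ * iteratedDeriv k g 0

lemma coeff_taySer (g : ℂ → ℂ) (k : ℕ) :
    PowerSeries.coeff k (taySer g) = ((k.factorial : ℕ) : ℂ)⁻¹ * iteratedDeriv k g 0 :=
  PowerSeries.coeff_mk _ _

lemma taySer_congr {f g : ℂ → ℂ} (h : f =ᶠ[nhds 0] g) : taySer f = taySer g := by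
  ext k; rw [coeff_taySer, coeff_taySer, h.iteratedDeriv_eq k]

lemma taySer_mul {f g : ℂ → ℂ} (hf : AnalyticAt ℂ f 0) (hg : AnalyticAt ℂ g 0) :
    taySer (fun z => f z * g z) = taySer f * taySer g := by
  ext k
  rw [coeff_taySer, iteratedDeriv_fun_mul hf.contDiffAt hg.contDiffAt, PowerSeries.coeff_mul,
    Finset.Nat.sum_antidiagonal_eq_sum_range_succ_mk, Finset.mul_sum]
  refine Finset.sum_congr rfl fun i hi => ?_
  simp only [coeff_taySer]
  have hik : i ≤ k := Nat.lt_succ_iff.1 (Finset.mem_range.1 hi)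
  rw [Nat.cast_choose ℂ hik]
  have h1 : ((k.factorial : ℕ) : ℂ) ≠ 0 := by exact_mod_cast Nat.factorial_ne_zero k
  have h2 : ((i.factorial : ℕ) : ℂ) ≠ 0 := by exact_mod_cast Nat.factorial_ne_zero i
  have h3 : (((k-i).factorial : ℕ) : ℂ) ≠ 0 := by exact_mod_cast Nat.factorial_ne_zero (k-i)
  field_simp

lemma taySer_add {f g : ℂ → ℂ} (hf : AnalyticAt ℂ f 0) (hg : AnalyticAt ℂ g 0) :
    taySer (fun z => f z + g z) = taySer f + taySer g := by
  ext k
  rw [coeff_taySer, iteratedDeriv_fun_add hf.contDiffAt hg.contDiffAt, map_add, coeff_taySer,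
    coeff_taySer, mul_add]

lemma taySer_const (c : ℂ) : taySer (fun _ => c) = PowerSeries.C c := by
  ext k
  rw [coeff_taySer, iteratedDeriv_const, PowerSeries.coeff_C]
  split_ifs with h <;> simp [h]

lemma taySer_id : taySer (fun z => z) = PowerSeries.X := by
  ext k
  rw [coeff_taySer, iteratedDeriv_fun_id_zero, PowerSeries.coeff_X]
  split_ifs with h <;> simp [h]

lemma taySer_pow {f : ℂ → ℂ} (hf : AnalyticAt ℂ f 0) (n : ℕ) :
    taySer (fun z => f z ^ n) = taySer f ^ n := by
  induction n with
  | zero => simpa using taySer_const 1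
  | succ n ih =>
    simp only [pow_succ]
    rw [taySer_mul (hf.fun_pow n) hf, ih]

lemma taySer_sum {ι : Type*} (s : Finset ι) (f : ι → ℂ → ℂ) (hf : ∀ i, AnalyticAt ℂ (f i) 0) :
    taySer (fun z => ∑ i ∈ s, f i z) = ∑ i ∈ s, taySer (f i) := by
  classical
  induction s using Finset.induction_on with
  | empty => simpa using taySer_const 0
  | insert a s ha ih =>
    simp only [Finset.sum_insert ha]
    rw [taySer_add (hf a) (Finset.analyticAt_fun_sum _ fun i _ => hf i), ih]

lemma taySer_deriv (f : ℂ → ℂ) : taySer (deriv f) = PowerSeries.derivative ℂ (taySer f) := by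
  ext k
  rw [coeff_taySer, PowerSeries.coeff_derivative, coeff_taySer, iteratedDeriv_succ',
    Nat.factorial_succ]
  have h1 : ((k.factorial : ℕ) : ℂ) ≠ 0 := by exact_mod_cast Nat.factorial_ne_zero k
  have h2 : ((k : ℂ) + 1) ≠ 0 := by exact_mod_cast Nat.succ_ne_zero k
  push_cast
  field_simp

lemma schur_aux (ω : ℂ → ℂ) (hω : DifferentiableOn ℂ ω (ball 0 1))
    (hb : ∀ z ∈ ball (0 : ℂ) 1, ‖ω z‖ ≤ 1) (Q : PowerSeries ℂ) (m : ℕ) (r ε : ℝ) (hr0 : 0 < r)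
    (hr1 : r < 1) (hε : 0 < ε) :
    ∑ k ∈ Finset.range m, (r ^ k) ^ 2 * ‖PowerSeries.coeff k (taySer ω * Q)‖ ^ 2 ≤
      (1 + ε) ^ 2 * ∑ k ∈ Finset.range m, (r ^ k) ^ 2 * ‖PowerSeries.coeff k Q‖ ^ 2 := by
  set W := taySer ω with hW
  have hsum : ∀ z ∈ ball (0 : ℂ) 1, HasSum (fun k => PowerSeries.coeff k W * z ^ k) (ω z) := by
    intro z hz
    have := Complex.hasSum_taylorSeries_on_ball hω hz
    have e : (fun k => PowerSeries.coeff k W * z ^ k) =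
        fun k : ℕ => ((k.factorial : ℕ) : ℂ)⁻¹ • (z - 0) ^ k • iteratedDeriv k ω 0 := by
      funext k
      rw [hW, coeff_taySer]; simp only [sub_zero, smul_eq_mul]; ring
    rw [e]; exact this
  have hrball : ∀ z ∈ sphere (0 : ℂ) 1, (r : ℂ) * z ∈ ball (0 : ℂ) 1 := by
    intro z hz
    simp only [mem_sphere_iff_norm, sub_zero] at hz
    simp [hz, abs_of_pos hr0, hr1]
  have hsr : Summable (fun k => ‖PowerSeries.coeff k W * (r : ℂ) ^ k‖) := by
    have := (hsum (r : ℂ) (by simpa using hrball 1 (by simp))).summable.norm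
    exact this
  have hunif := tendstoUniformlyOn_tsum_nat (f := fun k (z : ℂ) => PowerSeries.coeff k W * ((r : ℂ) * z) ^ k)
    (s := sphere (0 : ℂ) 1) hsr (by
      intro k z hz
      simp only [mem_sphere_iff_norm, sub_zero] at hz
      simp [mul_pow, hz])
  rw [Metric.tendstoUniformlyOn_iff] at hunif
  obtain ⟨M, hM, hmM⟩ := ((hunif ε hε).and (Filter.eventually_ge_atTop m)).exists
  set w : Polynomial ℂ := PowerSeries.trunc M (PowerSeries.rescale (r : ℂ) W) with hw
  set p : Polynomial ℂ := PowerSeries.trunc m (PowerSeries.rescale (r : ℂ) Q) with hp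
  have hweval : ∀ z ∈ sphere (0 : ℂ) 1, ‖w.eval z‖ ≤ 1 + ε := by
    intro z hz
    have h1 := hM z hz
    have e : w.eval z = ∑ k ∈ Finset.range M, PowerSeries.coeff k W * ((r : ℂ) * z) ^ k := by
      rw [hw, Polynomial.eval, PowerSeries.eval₂_trunc_eq_sum_range]
      refine Finset.sum_congr rfl fun k _ => ?_
      rw [PowerSeries.coeff_rescale, RingHom.id_apply]; ring
    rw [← e, (hsum _ (hrball z hz)).tsum_eq, dist_comm, dist_eq_norm] at h1
    calc ‖w.eval z‖ = ‖(w.eval z - ω (r * z)) + ω (r * z)‖ := by rw [sub_add_cancel]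
      _ ≤ _ := norm_add_le _ _
      _ ≤ _ := by linarith [hb _ (hrball z hz)]
  have hcoef : ∀ k < m, (w * p).coeff k = (r : ℂ) ^ k * PowerSeries.coeff k (W * Q) := by
    intro k hk
    rw [← PowerSeries.coeff_rescale, map_mul,
      PowerSeries.coeff_mul_eq_coeff_trunc_mul_trunc₂ _ _ (lt_of_lt_of_le hk hmM) hk,
      ← Polynomial.coe_mul, Polynomial.coeff_coe]
  have hpar1 := (w * p).sum_sq_norm_coeff_eq_circleAverage
  have hpar2 := p.sum_sq_norm_coeff_eq_circleAverage
  have hci : ∀ q : Polynomial ℂ, CircleIntegrable (fun z => ‖q.eval z‖ ^ 2) 0 1 := fun q =>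
    (by fun_prop : Continuous fun z : ℂ => ‖q.eval z‖ ^ 2).continuousOn.circleIntegrable'
  have hmono : Real.circleAverage (fun z => ‖(w * p).eval z‖ ^ 2) 0 1 ≤
      (1 + ε) ^ 2 * Real.circleAverage (fun z => ‖p.eval z‖ ^ 2) 0 1 := by
    rw [← smul_eq_mul ((1 + ε) ^ 2), ← Real.circleAverage_fun_smul]
    refine Real.circleAverage_mono (hci _) ((hci p).const_fun_smul) ?_
    intro z hz
    rw [abs_one] at hz
    simp only [Polynomial.eval_mul, norm_mul, mul_pow, smul_eq_mul]
    gcongr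
    exact hweval z hz
  rw [← hpar1, ← hpar2] at hmono
  have hl : ∑ k ∈ Finset.range m, (r ^ k) ^ 2 * ‖PowerSeries.coeff k (W * Q)‖ ^ 2 ≤
      ∑ i ∈ (w * p).support, ‖(w * p).coeff i‖ ^ 2 := by
    calc _ = ∑ k ∈ Finset.range m, ‖(w * p).coeff k‖ ^ 2 := by
          refine Finset.sum_congr rfl fun k hk => ?_
          rw [hcoef k (Finset.mem_range.1 hk)]
          simp [mul_pow, abs_of_pos hr0]
      _ ≤ ∑ k ∈ Finset.range m ∪ (w * p).support, ‖(w * p).coeff k‖ ^ 2 :=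
          Finset.sum_le_sum_of_subset_of_nonneg Finset.subset_union_left (fun _ _ _ => by positivity)
      _ = _ := by
          symm
          refine Finset.sum_subset Finset.subset_union_right fun k _ hk => ?_
          rw [Polynomial.notMem_support_iff.1 hk]; simp
  have hrr : ∑ i ∈ p.support, ‖p.coeff i‖ ^ 2 =
      ∑ k ∈ Finset.range m, (r ^ k) ^ 2 * ‖PowerSeries.coeff k Q‖ ^ 2 := by
    calc _ = ∑ k ∈ Finset.range m, ‖p.coeff k‖ ^ 2 := by
          refine Finset.sum_subset ?_ fun k _ hk => ?_
          · intro k hk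
            rw [Polynomial.mem_support_iff, hp, PowerSeries.coeff_trunc] at hk
            by_contra h
            rw [Finset.mem_range] at h
            simp [h] at hk
          · rw [Polynomial.notMem_support_iff.1 hk]; simp
      _ = _ := by
          refine Finset.sum_congr rfl fun k hk => ?_
          rw [hp, PowerSeries.coeff_trunc, if_pos (Finset.mem_range.1 hk), PowerSeries.coeff_rescale]
          simp [mul_pow, abs_of_pos hr0]
  rw [hrr] at hmono
  exact hl.trans hmono

lemma schur_bound (ω : ℂ → ℂ) (hω : DifferentiableOn ℂ ω (ball 0 1))
    (hb : ∀ z ∈ ball (0 : ℂ) 1, ‖ω z‖ ≤ 1) (Q : PowerSeries ℂ) (m : ℕ) :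
    ∑ k ∈ Finset.range m, ‖PowerSeries.coeff k (taySer ω * Q)‖ ^ 2 ≤
      ∑ k ∈ Finset.range m, ‖PowerSeries.coeff k Q‖ ^ 2 := by
  have h1 : Filter.Tendsto (fun r : ℝ => ∑ k ∈ Finset.range m, (r ^ k) ^ 2 *
      ‖PowerSeries.coeff k (taySer ω * Q)‖ ^ 2) (nhdsWithin 1 (Set.Iio 1))
      (nhds (∑ k ∈ Finset.range m, ‖PowerSeries.coeff k (taySer ω * Q)‖ ^ 2)) := by
    refine Filter.Tendsto.mono_left ?_ nhdsWithin_le_nhds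
    exact Continuous.tendsto' (by fun_prop) _ _ (by simp)
  have h2 : Filter.Tendsto (fun r : ℝ => (1 + (1 - r)) ^ 2 * ∑ k ∈ Finset.range m, (r ^ k) ^ 2 *
      ‖PowerSeries.coeff k Q‖ ^ 2) (nhdsWithin 1 (Set.Iio 1))
      (nhds (∑ k ∈ Finset.range m, ‖PowerSeries.coeff k Q‖ ^ 2)) := by
    refine Filter.Tendsto.mono_left ?_ nhdsWithin_le_nhds
    exact Continuous.tendsto' (by fun_prop) _ _ (by simp)
  refine le_of_tendsto_of_tendsto h1 h2 ?_
  filter_upwards [Ioo_mem_nhdsLT (show (0 : ℝ) < 1 by norm_num)] with r hr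
  exact schur_aux ω hω hb Q m r (1 - r) hr.1 hr.2 (by linarith [hr.2])

lemma real_induction (c : ℕ → ℝ) (x : ℕ → ℝ) (hx : ∀ k, 0 ≤ x k) (hx0 : x 0 = 1) (N : ℕ)
    (hc : ∀ k < N, (k : ℝ) ≤ c k)
    (hcl : ∀ m, ∑ k ∈ Finset.range m, (((k : ℝ) + 1) * x (k + 1)) ^ 2 ≤
      ∑ k ∈ Finset.range m, (c k * x k) ^ 2) :
    ∀ m ≤ N, x m ≤ ∏ j ∈ Finset.range m, c j / (j + 1) := by
  intro m
  induction m using Nat.strong_induction_on with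
  | _ m ih =>
    intro hm
    rcases Nat.eq_zero_or_pos m with rfl | hm0
    · simp [hx0]
    set P : ℕ → ℝ := fun m => ∏ j ∈ Finset.range m, c j / (j + 1) with hP
    have hc0 : ∀ k < N, 0 ≤ c k := fun k hk => le_trans (Nat.cast_nonneg k) (hc k hk)
    have hPm : 0 ≤ P m := Finset.prod_nonneg fun j hj =>
      div_nonneg (hc0 j (lt_of_lt_of_le (Finset.mem_range.1 hj) hm)) (by positivity)
    have e1 : ∑ k ∈ Finset.range m, (((k : ℝ) + 1) * x (k + 1)) ^ 2 =
        ∑ k ∈ Finset.range m, ((k : ℝ) * x k) ^ 2 + ((m : ℝ) * x m) ^ 2 := by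
      rw [← Finset.sum_range_succ (fun k : ℕ => ((k : ℝ) * x k) ^ 2), Finset.sum_range_succ']
      simp
    have e2 : ((m : ℝ) * x m) ^ 2 ≤ ∑ k ∈ Finset.range m, (c k ^ 2 - (k : ℝ) ^ 2) * x k ^ 2 := by
      have h1 := hcl m
      have h2 : ∑ k ∈ Finset.range m, (c k ^ 2 - (k : ℝ) ^ 2) * x k ^ 2 =
          ∑ k ∈ Finset.range m, (c k * x k) ^ 2 - ∑ k ∈ Finset.range m, ((k : ℝ) * x k) ^ 2 := by
        rw [← Finset.sum_sub_distrib]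
        exact Finset.sum_congr rfl fun k _ => by ring
      rw [e1] at h1
      linarith
    have e3 : ∑ k ∈ Finset.range m, (c k ^ 2 - (k : ℝ) ^ 2) * x k ^ 2 ≤
        ∑ k ∈ Finset.range m, (c k ^ 2 - (k : ℝ) ^ 2) * P k ^ 2 := by
      refine Finset.sum_le_sum fun k hk => ?_
      have hkm := Finset.mem_range.1 hk
      have h1 : (k : ℝ) ^ 2 ≤ c k ^ 2 := by
        have := hc k (lt_of_lt_of_le hkm hm)
        gcongr
      have h2 : x k ^ 2 ≤ P k ^ 2 := by
        have := ih k hkm (by omega)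
        have := hx k
        gcongr
      exact mul_le_mul_of_nonneg_left h2 (by linarith)
    have e4 : ∑ k ∈ Finset.range m, (c k ^ 2 - (k : ℝ) ^ 2) * P k ^ 2 = ((m : ℝ) * P m) ^ 2 := by
      have := Finset.sum_range_sub (fun k : ℕ => ((k : ℝ) * P k) ^ 2) m
      simp only [Nat.cast_zero, zero_mul, ne_eq, OfNat.ofNat_ne_zero, not_false_eq_true, zero_pow,
        sub_zero] at this
      rw [← this]
      refine Finset.sum_congr rfl fun k _ => ?_
      have hk : P (k + 1) = P k * (c k / (k + 1)) := Finset.prod_range_succ _ _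
      have hk1 : ((k : ℝ) + 1) ≠ 0 := by positivity
      rw [hk]
      push_cast
      field_simp
    have e5 : ((m : ℝ) * x m) ^ 2 ≤ ((m : ℝ) * P m) ^ 2 := by linarith
    have hmpos : (0 : ℝ) < m := by exact_mod_cast hm0
    have e6 := abs_le_of_sq_le_sq e5 (by positivity)
    exact le_of_mul_le_mul_left ((le_abs_self _).trans e6) hmpos

theorem inverse_coeff_bound_case_i (A B δ : ℝ) (hB : -1 ≤ B) (hBA : B < A) (hA : A ≤ 1)
    (hδ : δ = (1 - A) / (1 - B))
    (f F : ℂ → ℂ) (hf : IsJanowskiStarlike A B f)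
    (Acoef : ℕ → ℂ) (hA0 : Acoef 0 = 0) (hA1 : Acoef 1 = 1)
    (ρ : ℝ) (hρ : 0 < ρ)
    (hF : ∀ w ∈ ball (0 : ℂ) ρ,
      F w ∈ ball (0 : ℂ) 1 ∧ f (F w) = w ∧
        HasSum (fun m : ℕ => Acoef m * w ^ m) (F w))
    (n : ℕ) (hn : 2 ≤ n) (hδ0 : 0 ≤ δ) (hδ2 : δ < 2 / n) :
    ‖Acoef n‖ ≤ (1 / n) * ∏ j ∈ Finset.range (n - 1), (n * (A - B) + B * j) / (j + 1) := by
  obtain ⟨hfa, hf0, hf1, ω, hωa, hωb, hode⟩ := hf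
  have hball : ball (0 : ℂ) 1 ∈ nhds (0 : ℂ) := ball_mem_nhds 0 one_pos
  have hfat : AnalyticAt ℂ f 0 :=
    ((isOpen_ball.analyticOn_iff_analyticOnNhd).1 hfa) 0 (mem_ball_self one_pos)
  have hωat : AnalyticAt ℂ ω 0 :=
    ((isOpen_ball.analyticOn_iff_analyticOnNhd).1 hωa) 0 (mem_ball_self one_pos)
  -- the series of f
  have hX : PowerSeries.X ∣ taySer f := by
    rw [PowerSeries.X_dvd_iff, ← PowerSeries.coeff_zero_eq_constantCoeff_apply, coeff_taySer]
    simp [hf0]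
  obtain ⟨u, hu⟩ := hX
  have hu1 : PowerSeries.constantCoeff u = 1 := by
    have h := coeff_taySer f 1
    rw [hu, PowerSeries.coeff_succ_X_mul, PowerSeries.coeff_zero_eq_constantCoeff_apply,
      iteratedDeriv_one, hf1] at h
    simpa using h
  -- F is analytic at 0 with coefficients Acoef
  have hFps : HasFPowerSeriesAt F (FormalMultilinearSeries.ofScalars ℂ Acoef) 0 := by
    rw [hasFPowerSeriesAt_iff]
    filter_upwards [ball_mem_nhds (0 : ℂ) hρ] with z hz
    have := (hF z hz).2.2
    simpa [FormalMultilinearSeries.coeff_ofScalars, mul_comm] using this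
  have hFat : AnalyticAt ℂ F 0 := hFps.analyticAt
  have hFcoef : ∀ k, iteratedDeriv k F 0 = (k.factorial : ℂ) * Acoef k := by
    intro k
    obtain ⟨r, hr⟩ := hFps
    have h := hr.factorial_smul (1 : ℂ) k
    rw [iteratedDeriv_eq_iteratedFDeriv, ← h]
    simp [FormalMultilinearSeries.ofScalars]
  have hF0 : F 0 = 0 := by
    have := hFcoef 0
    simpa [hA0] using this
  -- left inverse
  have hstrict : HasStrictDerivAt f 1 0 := by
    have := hfat.hasStrictDerivAt
    rwa [hf1] at this
  have hleft : ∀ᶠ z in nhds (0 : ℂ), F (f z) = z := by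
    have h1 := hstrict.eventually_left_inverse one_ne_zero
    have hft : Filter.Tendsto f (nhds 0) (nhds 0) := by
      have := hfat.continuousAt.tendsto
      rwa [hf0] at this
    have hFt : Filter.Tendsto F (nhds 0) (nhds 0) := by
      have := hFat.continuousAt.tendsto
      rwa [hF0] at this
    filter_upwards [h1, (hFt.comp hft).eventually h1, hft.eventually (ball_mem_nhds (0 : ℂ) hρ)]
      with z hz1 hz2 hz3
    simp only [Function.comp_apply] at hz2
    rw [(hF (f z) hz3).2.1, hz1] at hz2
    exact hz2.symm
  obtain ⟨H, hH, hFH⟩ := hFat.exists_eq_sum_add_pow_mul (n + 1)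
  have hHf : AnalyticAt ℂ (fun z => H (f z)) 0 := by
    refine AnalyticAt.fun_comp ?_ hfat
    rwa [hf0]
  have hser : (PowerSeries.X : PowerSeries ℂ) =
      ∑ k ∈ Finset.range (n+1), PowerSeries.C (Acoef k) * (PowerSeries.X * u) ^ k
        + (PowerSeries.X * u) ^ (n+1) * taySer (fun z => H (f z)) := by
    rw [← hu, ← taySer_pow hfat, ← taySer_mul (hfat.fun_pow _) hHf]
    have h1 : ∀ k, PowerSeries.C (Acoef k) * taySer f ^ k =
        taySer (fun z => Acoef k * f z ^ k) := by
      intro k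
      rw [taySer_mul analyticAt_const (hfat.fun_pow _), taySer_const, taySer_pow hfat]
    have h2 : ∀ k, AnalyticAt ℂ (fun z => Acoef k * f z ^ k) 0 := fun k =>
      analyticAt_const.fun_mul (hfat.fun_pow _)
    simp only [h1]
    rw [← taySer_sum _ _ h2, ← taySer_add (Finset.analyticAt_fun_sum _ fun i _ => h2 i)
      ((hfat.fun_pow _).fun_mul hHf), ← taySer_id]
    refine taySer_congr ?_
    filter_upwards [hleft] with z hz
    rw [hFH (f z)] at hz
    refine hz.symm.trans ?_
    rw [smul_eq_mul]
    congr 1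
    refine Finset.sum_congr rfl fun k _ => ?_
    rw [hFcoef k, smul_eq_mul]
    have hk : ((k.factorial : ℕ) : ℂ) ≠ 0 := by exact_mod_cast Nat.factorial_ne_zero k
    field_simp
  have hlag := lagrange_formal u _ hu1 Acoef n (by omega) hser
  -- differential equation
  have hid : AnalyticAt ℂ (fun z : ℂ => z) 0 := analyticAt_id
  have hodeF : PowerSeries.X * PowerSeries.derivative ℂ (PowerSeries.X * u) *
      (1 + PowerSeries.C (B : ℂ) * PowerSeries.X * taySer ω) =
      PowerSeries.X * u * (1 + PowerSeries.C (A : ℂ) * PowerSeries.X * taySer ω) := by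
    have hm : ∀ c : ℂ, 1 + PowerSeries.C c * PowerSeries.X * taySer ω =
        taySer (fun z => 1 + c * z * ω z) := by
      intro c
      rw [taySer_add analyticAt_const ((analyticAt_const.fun_mul hid).fun_mul hωat),
        taySer_mul (analyticAt_const.fun_mul hid) hωat,
        taySer_mul analyticAt_const hid, taySer_const, taySer_const]
      rw [taySer_id, map_one]
    have hma : ∀ c : ℂ, AnalyticAt ℂ (fun z => 1 + c * z * ω z) 0 := fun c =>
      analyticAt_const.fun_add ((analyticAt_const.fun_mul hid).fun_mul hωat)
    rw [hm, hm, ← hu, ← taySer_deriv, ← taySer_id, ← taySer_mul hid hfat.deriv,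
      ← taySer_mul (hid.fun_mul hfat.deriv) (hma _), ← taySer_mul hfat (hma _)]
    refine taySer_congr ?_
    filter_upwards [hball] with z hz
    exact hode z hz
  have hG := ode_formal u (taySer ω) hu1 A B n hodeF
  set g := u⁻¹ ^ n with hg
  have hωd : DifferentiableOn ℂ ω (ball 0 1) := hωa.differentiableOn
  have hcl : ∀ m, ∑ k ∈ Finset.range m, (((k : ℝ) + 1) * ‖PowerSeries.coeff (k + 1) g‖) ^ 2 ≤
      ∑ k ∈ Finset.range m, ((n * (A - B) + B * k) * ‖PowerSeries.coeff k g‖) ^ 2 := by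
    intro m
    have h := schur_bound ω hωd hωb (-(PowerSeries.C (n * ((A : ℂ) - B)) * g +
      PowerSeries.C (B : ℂ) * (PowerSeries.X * PowerSeries.derivative ℂ g))) m
    rw [← hG] at h
    convert h using 2 with k _ k _
    · rw [PowerSeries.coeff_derivative, norm_mul, mul_comm]
      congr 2
      rw [← Nat.cast_succ, ← Nat.cast_succ, Complex.norm_natCast]
    · have e : PowerSeries.coeff k (PowerSeries.X * PowerSeries.derivative ℂ g) =
          k * PowerSeries.coeff k g := by
        rcases k with _ | k
        · simp
        · rw [PowerSeries.coeff_succ_X_mul, PowerSeries.coeff_derivative]; push_cast; ring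
      rw [map_neg, norm_neg, map_add, PowerSeries.coeff_C_mul, PowerSeries.coeff_C_mul, e]
      have e2 : (n * ((A : ℂ) - B)) * PowerSeries.coeff k g + B * (k * PowerSeries.coeff k g) =
          ((n * (A - B) + B * k : ℝ) : ℂ) * PowerSeries.coeff k g := by push_cast; ring
      rw [e2, norm_mul, Complex.norm_real, mul_pow, mul_pow, Real.norm_eq_abs, sq_abs]
  have h1B : 0 < 1 - B := by linarith
  have hnpos : (0 : ℝ) < n := by exact_mod_cast (by omega : 0 < n)
  have hc : ∀ k < n - 1, (k : ℝ) ≤ n * (A - B) + B * k := by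
    intro k hk
    have hk' : (k : ℝ) + 2 ≤ n := by exact_mod_cast (by omega : k + 2 ≤ n)
    rw [hδ, div_lt_div_iff₀ h1B hnpos] at hδ2
    nlinarith
  have hx0 : ‖PowerSeries.coeff 0 g‖ = 1 := by
    rw [hg, PowerSeries.coeff_zero_eq_constantCoeff_apply, map_pow, PowerSeries.constantCoeff_inv,
      hu1]
    simp
  have hfin := real_induction (fun k => n * (A - B) + B * k) (fun k => ‖PowerSeries.coeff k g‖)
    (fun _ => norm_nonneg _) hx0 (n - 1) hc hcl (n - 1) le_rfl
  have hnorm : (n : ℝ) * ‖Acoef n‖ = ‖PowerSeries.coeff (n - 1) g‖ := by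
    rw [← hlag, norm_mul, Complex.norm_natCast]
  rw [one_div, ← div_eq_inv_mul, le_div_iff₀ hnpos, mul_comm, hnorm]
  exact hfin
end
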